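/- arXiv:2005.02800 — 10 statements merged into one kernel-verified Lean document; each statement's English description precedes it below -/
import Mathlib

section
/- For every γ > 0 and every u > 0, ∫₀^∞ ∫₀^∞ (v·e^{-v·u}) · (v^{w-1}·e^{-v}/Γ(w)) · (w^{γ-1}·e^{-w}/Γ(γ)) dv dw = γ/((1+u)·(1+log(1+u))^{1+γ}). In other words, the H-distribution is the marginal of the hierarchy u|(v,w) ~ Ga(1,v), v|w ~ Ga(w,1), w ~ Ga(γ,1), where Ga(a,b) denotes the gamma distribution with shape a and rate b (density b^a x^{a-1} e^{-bx}/Γ(a)). -/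
open MeasureTheory Real Filter Set

/-- The integrand of the gamma hierarchy, with `v` integrated out. -/
lemma integral_gamma_mixture_of_exponential (γ : ℝ) {u w : ℝ} (hu : 0 < u) (hw : 0 < w) :
    (∫ v in Set.Ioi (0:ℝ),
        (v * Real.exp (-(v * u))) * (v ^ (w - 1) * Real.exp (-v) / Real.Gamma w) *
          (w ^ (γ - 1) * Real.exp (-w) / Real.Gamma γ))
      = 1 / ((1 + u) * Real.Gamma γ) *
          (w ^ (γ + 1 - 1) * Real.exp (-((1 + Real.log (1 + u)) * w))) := by
  have hu1 : 0 < 1 + u := by linarith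
  have hΓ : Real.Gamma w ≠ 0 := (Real.Gamma_pos_of_pos hw).ne'
  have hv : ∀ v ∈ Set.Ioi (0:ℝ),
      (v * Real.exp (-(v * u))) * (v ^ (w - 1) * Real.exp (-v) / Real.Gamma w) *
          (w ^ (γ - 1) * Real.exp (-w) / Real.Gamma γ)
        = (w ^ (γ - 1) * Real.exp (-w) / Real.Gamma γ / Real.Gamma w) *
          (v ^ (w + 1 - 1) * Real.exp (-((1 + u) * v))) := by
    intro v hv
    have hpow : v ^ (w + 1 - 1) = v ^ (w - 1) * v := by
      rw [← Real.rpow_add_one (ne_of_gt hv)]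
      ring_nf
    have hexp : Real.exp (-((1 + u) * v)) = Real.exp (-(v * u)) * Real.exp (-v) := by
      rw [← Real.exp_add]
      ring_nf
    rw [hpow, hexp]
    ring
  have hwpow : w ^ (γ + 1 - 1) = w ^ (γ - 1) * w := by
    rw [← Real.rpow_add_one hw.ne']
    ring_nf
  have hupow : (1 / (1 + u)) ^ (w + 1) = Real.exp (-(Real.log (1 + u) * w)) / (1 + u) := by
    rw [Real.rpow_add_one (by positivity), Real.rpow_def_of_pos (by positivity), one_div,
      Real.log_inv, neg_mul, div_eq_mul_inv]
  have hexp : Real.exp (-((1 + Real.log (1 + u)) * w))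
      = Real.exp (-w) * Real.exp (-(Real.log (1 + u) * w)) := by
    rw [← Real.exp_add]
    ring_nf
  rw [setIntegral_congr_fun measurableSet_Ioi hv, integral_const_mul,
    Real.integral_rpow_mul_exp_neg_mul_Ioi (by linarith) hu1, Real.Gamma_add_one hw.ne',
    hwpow, hupow, hexp]
  field_simp

/-- The `H`-distribution is the marginal of the gamma hierarchy
`u | (v,w) ~ Ga(1,v)`, `v | w ~ Ga(w,1)`, `w ~ Ga(γ,1)`:
for all `γ > 0` and `u > 0`,
`∫₀^∞ ∫₀^∞ (v e^{-vu}) (v^{w-1} e^{-v}/Γ(w)) (w^{γ-1} e^{-w}/Γ(γ)) dv dw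
  = γ/((1+u)(1+log(1+u))^{1+γ})`. -/
theorem H_dist_gamma_hierarchy (γ u : ℝ) (hγ : 0 < γ) (hu : 0 < u) :
    (∫ w in Set.Ioi (0:ℝ), ∫ v in Set.Ioi (0:ℝ),
        (v * Real.exp (-(v * u))) * (v ^ (w - 1) * Real.exp (-v) / Real.Gamma w) *
          (w ^ (γ - 1) * Real.exp (-w) / Real.Gamma γ))
      = γ / ((1 + u) * (1 + Real.log (1 + u)) ^ (1 + γ)) := by
  have hlog : 0 < 1 + Real.log (1 + u) := by
    have := Real.log_pos (show 1 < 1 + u by linarith)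
    linarith
  have hΓ : Real.Gamma γ ≠ 0 := (Real.Gamma_pos_of_pos hγ).ne'
  rw [setIntegral_congr_fun measurableSet_Ioi
      fun w hw => integral_gamma_mixture_of_exponential γ hu hw,
    integral_const_mul, Real.integral_rpow_mul_exp_neg_mul_Ioi (by linarith) hlog,
    Real.Gamma_add_one hγ.ne', Real.div_rpow zero_le_one hlog.le, Real.one_rpow, add_comm γ 1]
  field_simp
end

section
/- For all r ≥ 0 and c > 0, (1 + log(1+r))/(1 + log(1 + r/c)) ≤ 1 + log(1+c). -/
open Real

/-- For all `r ≥ 0` and `c > 0`,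
`(1 + log(1+r))/(1 + log(1 + r/c)) ≤ 1 + log(1+c)`. -/
theorem log_ratio_le_one_add_log (r c : ℝ) (hr : 0 ≤ r) (hc : 0 < c) :
    (1 + Real.log (1 + r)) / (1 + Real.log (1 + r / c)) ≤ 1 + Real.log (1 + c) := by
  have hs : 0 ≤ r / c := div_nonneg hr hc.le
  have hA : 0 ≤ Real.log (1 + r / c) := Real.log_nonneg (by linarith)
  have hB : 0 ≤ Real.log (1 + c) := Real.log_nonneg (by linarith)
  have hlog : Real.log (1 + r) ≤ Real.log (1 + c) + Real.log (1 + r / c) := by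
    rw [← Real.log_mul (by positivity) (by positivity)]
    apply Real.log_le_log (by positivity)
    have hcr : c * (r / c) = r := by field_simp
    nlinarith
  rw [div_le_iff₀ (by positivity)]
  linarith [mul_nonneg hB hA]
end

section
/- Fix γ > 0 and s ∈ (0,1], and let f_EH(x) = (1-s)·φ(x;0,1) + s·∫₀^∞ φ(x;0,u)·H(u;γ) du. Then lim_{|x|→∞} |x|·(log|x|)^{1+γ}·f_EH(x) = s·γ/2^{1+γ}. In particular, f_EH(x) is asymptotic to a positive constant multiple of |x|^{-1}(log|x|)^{-1-γ} as |x| → ∞. -/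
open MeasureTheory Real Filter Set

/-- Normal density with mean `0` and variance `u`. -/
noncomputable def normPdf (z u : ℝ) : ℝ :=
  (Real.sqrt (2 * Real.pi * u))⁻¹ * Real.exp (-(z ^ 2) / (2 * u))

/-- Density of the `H`-distribution with parameter `γ`. -/
noncomputable def Hdens (γ u : ℝ) : ℝ :=
  γ / ((1 + u) * (1 + Real.log (1 + u)) ^ (1 + γ))

/-- The extremely heavily-tailed error density: two-component mixture of the
standard normal and a scale mixture of normals by the `H`-distribution. -/
noncomputable def fEH (γ s x : ℝ) : ℝ :=
  (1 - s) * normPdf x 1 + s * ∫ u in Set.Ioi (0:ℝ), normPdf x u * Hdens γ u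

/-- The integrand of the rescaled mixture after the substitution `u = a ^ 2 / w ^ 2`. -/
noncomputable def rescaledIntegrand (γ a w : ℝ) : ℝ :=
  2 * (√(2 * π))⁻¹ * exp (-(w ^ 2) / 2) *
    (γ * (a ^ 2 / w ^ 2 / (1 + a ^ 2 / w ^ 2)) *
      (log a / (1 + log (1 + a ^ 2 / w ^ 2))) ^ (1 + γ))

lemma rescaledIntegrand_eq {γ a w : ℝ} (ha : 1 < a) (hw : 0 < w) :
    a * log a ^ (1 + γ) * (|(-2 : ℝ)| * w ^ ((-2 : ℝ) - 1) *
      (a ^ 2 * (normPdf a (a ^ 2 * w ^ (-2 : ℝ)) * Hdens γ (a ^ 2 * w ^ (-2 : ℝ))))) =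
      rescaledIntegrand γ a w := by
  have ha0 : 0 < a := by linarith
  have h2 : w ^ (-2 : ℝ) = (w ^ 2)⁻¹ := by
    rw [rpow_neg hw.le]; norm_cast
  have h3 : w ^ ((-2 : ℝ) - 1) = (w ^ 3)⁻¹ := by
    rw [show (-2 : ℝ) - 1 = -3 by norm_num, rpow_neg hw.le]; norm_cast
  have hu : 0 < a ^ 2 / w ^ 2 := by positivity
  have hl : 0 < log (1 + a ^ 2 / w ^ 2) := log_pos (by linarith)
  have hs : √(2 * π * (a ^ 2 / w ^ 2)) = √(2 * π) * (a / w) := by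
    rw [← div_pow, sqrt_mul (by positivity), sqrt_sq (by positivity)]
  have he : -(a ^ 2) / (2 * (a ^ 2 / w ^ 2)) = -(w ^ 2) / 2 := by
    field_simp
  have habs : |(-2 : ℝ)| = 2 := by norm_num
  rw [h2, h3, ← div_eq_mul_inv (a ^ 2), normPdf, Hdens, rescaledIntegrand, hs, he, habs,
    div_rpow (log_pos ha).le (by positivity)]
  have hp : 0 < (1 + log (1 + a ^ 2 / w ^ 2)) ^ (1 + γ) := by positivity
  have hπ : 0 < √(2 * π) := by positivity
  generalize (1 + log (1 + a ^ 2 / w ^ 2)) ^ (1 + γ) = P at *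
  generalize √(2 * π) = S at *
  field_simp

lemma rescaled_integral_eq {γ a : ℝ} (ha : 1 < a) :
    a * log a ^ (1 + γ) * ∫ u in Ioi (0 : ℝ), normPdf a u * Hdens γ u =
      ∫ w in Ioi (0 : ℝ), rescaledIntegrand γ a w := by
  have ha2 : 0 < a ^ 2 := by positivity
  have h1 := integral_comp_mul_left_Ioi (fun u => normPdf a u * Hdens γ u) 0 ha2
  rw [mul_zero, smul_eq_mul, eq_inv_mul_iff_mul_eq₀ ha2.ne', ← integral_const_mul] at h1
  rw [← h1, ← integral_comp_rpow_Ioi _ (show (-2 : ℝ) ≠ 0 by norm_num), ← integral_const_mul]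
  refine setIntegral_congr_fun measurableSet_Ioi fun w hw => ?_
  simpa only [smul_eq_mul] using rescaledIntegrand_eq ha hw

lemma one_add_rpow_le_mul_exp {p t : ℝ} (hp : 1 ≤ p) (ht : 0 ≤ t) :
    (1 + t) ^ p ≤ (4 * p) ^ p * exp (t / 4) := by
  have hp0 : 0 < p := by linarith
  have h1 : 1 + t ≤ 4 * p * exp (t / (4 * p)) := by
    have h := mul_le_mul_of_nonneg_left (add_one_le_exp (t / (4 * p)))
      (by positivity : 0 ≤ 4 * p)
    have h' : 4 * p * (t / (4 * p) + 1) = t + 4 * p := by field_simp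
    linarith
  calc (1 + t) ^ p ≤ (4 * p * exp (t / (4 * p))) ^ p := by gcongr
    _ = (4 * p) ^ p * exp (t / 4) := by
      rw [mul_rpow (by positivity) (exp_pos _).le, ← exp_mul]
      congr 2
      field_simp

lemma log_div_one_add_log_le {a w : ℝ} (ha : 1 < a) (hw : 0 < w) :
    log a / (1 + log (1 + a ^ 2 / w ^ 2)) ≤ 1 + w ^ 2 := by
  have ha0 : 0 < a := by linarith
  have hu : 0 < a ^ 2 / w ^ 2 := by positivity
  have hl : 0 < log (1 + a ^ 2 / w ^ 2) := log_pos (by linarith)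
  have hm : a ^ 2 ≤ (1 + a ^ 2 / w ^ 2) * (1 + w ^ 2) := by
    have : (1 + a ^ 2 / w ^ 2) * (1 + w ^ 2) = 1 + w ^ 2 + a ^ 2 / w ^ 2 + a ^ 2 := by
      field_simp
      ring
    rw [this]
    have := sq_nonneg w
    linarith
  have h := log_le_log (by positivity) hm
  rw [log_mul (by positivity) (by positivity), log_pow, Nat.cast_ofNat] at h
  have hB : log (1 + w ^ 2) ≤ w ^ 2 := by
    have := log_le_sub_one_of_pos (show 0 < 1 + w ^ 2 by positivity)
    linarith
  have hA := log_pos ha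
  rw [div_le_iff₀ (by positivity)]
  nlinarith [mul_nonneg (sq_nonneg w) hl.le]

lemma norm_rescaledIntegrand_le {γ a w : ℝ} (hγ : 0 < γ) (ha : 1 < a) (hw : 0 < w) :
    ‖rescaledIntegrand γ a w‖ ≤
      2 * (√(2 * π))⁻¹ * γ * (4 * (1 + γ)) ^ (1 + γ) * exp (-(1 / 4) * w ^ 2) := by
  have ha0 : 0 < a := by linarith
  have hu : 0 < a ^ 2 / w ^ 2 := by positivity
  have hl : 0 < log (1 + a ^ 2 / w ^ 2) := log_pos (by linarith)
  have hA := log_pos ha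
  have hq : a ^ 2 / w ^ 2 / (1 + a ^ 2 / w ^ 2) ≤ 1 := by
    rw [div_le_one (by positivity)]; linarith
  have hr : (log a / (1 + log (1 + a ^ 2 / w ^ 2))) ^ (1 + γ) ≤
      (4 * (1 + γ)) ^ (1 + γ) * exp (w ^ 2 / 4) :=
    (rpow_le_rpow (by positivity) (log_div_one_add_log_le ha hw) (by positivity)).trans
      (one_add_rpow_le_mul_exp (by linarith) (sq_nonneg w))
  rw [rescaledIntegrand, norm_of_nonneg (by positivity)]
  calc _ ≤ 2 * (√(2 * π))⁻¹ * exp (-(w ^ 2) / 2) *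
        (γ * 1 * ((4 * (1 + γ)) ^ (1 + γ) * exp (w ^ 2 / 4))) := by gcongr
    _ = 2 * (√(2 * π))⁻¹ * γ * (4 * (1 + γ)) ^ (1 + γ) *
        (exp (-(w ^ 2) / 2) * exp (w ^ 2 / 4)) := by ring
    _ = _ := by rw [← exp_add]; congr 2; ring

lemma tendsto_log_div_one_add_log {w : ℝ} (hw : 0 < w) :
    Tendsto (fun a : ℝ => log a / (1 + log (1 + a ^ 2 / w ^ 2))) atTop (nhds (1 / 2)) := by
  have hsq : Tendsto (fun a : ℝ => (a ^ 2)⁻¹ + (w ^ 2)⁻¹) atTop (nhds (0 + (w ^ 2)⁻¹)) :=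
    (tendsto_inv_atTop_zero.comp (tendsto_pow_atTop two_ne_zero)).add_const _
  have hlog := (hsq.log (by positivity)).const_add 1
  have h := ((hlog.div_atTop tendsto_log_atTop).const_add 2).inv₀ (by norm_num)
  rw [add_zero, inv_eq_one_div (2 : ℝ)] at h
  refine h.congr' ?_
  filter_upwards [eventually_gt_atTop 1] with a ha
  have ha0 : 0 < a := by linarith
  have hA := log_pos ha
  have hm : 1 + a ^ 2 / w ^ 2 = a ^ 2 * ((a ^ 2)⁻¹ + (w ^ 2)⁻¹) := by
    field_simp
  rw [hm, log_mul (by positivity) (by positivity), log_pow, Nat.cast_ofNat,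
    ← inv_div (1 + _) (log a)]
  congr 1
  field_simp
  ring

lemma tendsto_rescaledIntegrand {γ w : ℝ} (hw : 0 < w) :
    Tendsto (fun a => rescaledIntegrand γ a w) atTop
      (nhds (2 * (√(2 * π))⁻¹ * exp (-(w ^ 2) / 2) * (γ * 1 * (1 / 2) ^ (1 + γ)))) := by
  have hq : Tendsto (fun a : ℝ => a ^ 2 / w ^ 2 / (1 + a ^ 2 / w ^ 2)) atTop (nhds 1) := by
    have h1 : Tendsto (fun a : ℝ => 1 + a ^ 2 / w ^ 2) atTop atTop :=
      tendsto_atTop_add_const_left _ _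
        ((tendsto_pow_atTop two_ne_zero).atTop_div_const (by positivity))
    have h2 := (tendsto_inv_atTop_zero.comp h1).const_sub 1
    rw [sub_zero] at h2
    refine h2.congr fun a => ?_
    have : 0 < 1 + a ^ 2 / w ^ 2 := by positivity
    simp only [Function.comp_apply]
    rw [eq_div_iff this.ne', sub_mul, inv_mul_cancel₀ this.ne']
    ring
  exact ((hq.const_mul γ).mul
    ((tendsto_log_div_one_add_log hw).rpow_const (Or.inl (by norm_num)))).const_mul _

lemma integral_limit_rescaledIntegrand (γ : ℝ) :
    ∫ w in Ioi (0 : ℝ), 2 * (√(2 * π))⁻¹ * exp (-(w ^ 2) / 2) * (γ * 1 * (1 / 2) ^ (1 + γ)) =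
      γ / 2 ^ (1 + γ) := by
  have h := integral_gaussian_Ioi (1 / 2)
  have he : ∀ w : ℝ, -(w ^ 2) / 2 = -(1 / 2) * w ^ 2 := fun w => by ring
  simp only [he]
  rw [integral_mul_const, integral_const_mul, h, show π / (1 / 2) = 2 * π by ring,
    div_rpow zero_le_one two_pos.le, one_rpow]
  have hπ : 0 < √(2 * π) := by positivity
  have h2 : (0 : ℝ) < 2 ^ (1 + γ) := by positivity
  field_simp

/-- Tail behavior of the scale mixture component. -/
lemma tendsto_scale_mixture {γ : ℝ} (hγ : 0 < γ) :
    Tendsto (fun a : ℝ => a * log a ^ (1 + γ) * ∫ u in Ioi (0 : ℝ), normPdf a u * Hdens γ u)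
      atTop (nhds (γ / 2 ^ (1 + γ))) := by
  rw [← integral_limit_rescaledIntegrand]
  have h : Tendsto (fun a => ∫ w in Ioi (0 : ℝ), rescaledIntegrand γ a w) atTop
      (nhds (∫ w in Ioi (0 : ℝ),
        2 * (√(2 * π))⁻¹ * exp (-(w ^ 2) / 2) * (γ * 1 * (1 / 2) ^ (1 + γ)))) := by
    refine tendsto_integral_filter_of_dominated_convergence
      (fun w => 2 * (√(2 * π))⁻¹ * γ * (4 * (1 + γ)) ^ (1 + γ) * exp (-(1 / 4) * w ^ 2))
      ?_ ?_ ?_ ?_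
    · refine Eventually.of_forall fun a => Measurable.aestronglyMeasurable ?_
      unfold rescaledIntegrand
      fun_prop
    · filter_upwards [eventually_gt_atTop 1] with a ha
      filter_upwards [ae_restrict_mem measurableSet_Ioi] with w hw
      exact norm_rescaledIntegrand_le hγ ha hw
    · exact ((integrable_exp_neg_mul_sq (by norm_num)).const_mul _).integrableOn
    · filter_upwards [ae_restrict_mem measurableSet_Ioi] with w hw
      exact tendsto_rescaledIntegrand hw
  refine h.congr' ?_
  filter_upwards [eventually_gt_atTop 1] with a ha
  exact (rescaled_integral_eq ha).symm

/-- The standard normal component is negligible in the tail. -/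
lemma tendsto_normal_component {γ : ℝ} (hγ : 0 < γ) :
    Tendsto (fun a : ℝ => a * log a ^ (1 + γ) * normPdf a 1) atTop (nhds 0) := by
  have h := (tendsto_rpow_mul_exp_neg_mul_atTop_nhds_zero (2 + γ) (1 / 2)
    (by norm_num)).const_mul (√(2 * π * 1))⁻¹
  rw [mul_zero] at h
  refine squeeze_zero' ?_ ?_ h
  · filter_upwards [eventually_gt_atTop 1] with a ha
    have := log_pos ha
    unfold normPdf
    positivity
  · filter_upwards [eventually_gt_atTop 1] with a ha
    have ha0 : 0 < a := by linarith
    have hA := log_pos ha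
    have hlog : log a ^ (1 + γ) ≤ a ^ (1 + γ) :=
      rpow_le_rpow hA.le (log_le_self ha0.le) (by positivity)
    have hexp : exp (-(a ^ 2) / (2 * 1)) ≤ exp (-(1 / 2) * a) := by
      rw [exp_le_exp]; nlinarith
    have hpow : a ^ (2 + γ) = a * a ^ (1 + γ) := by
      rw [show 2 + γ = 1 + (1 + γ) by ring, rpow_add ha0, rpow_one]
    rw [normPdf, hpow]
    calc _ ≤ a * a ^ (1 + γ) * ((√(2 * π * 1))⁻¹ * exp (-(1 / 2) * a)) := by gcongr
      _ = _ := by ring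

lemma fEH_abs (γ s x : ℝ) : fEH γ s |x| = fEH γ s x := by
  simp only [fEH, normPdf, sq_abs]

/-- Tail behavior of the EH density: for `γ > 0` and `s ∈ (0,1]`,
`|x| (log|x|)^{1+γ} f_EH(x) → s γ / 2^{1+γ}` as `|x| → ∞`; in particular
`f_EH(x) ≍ |x|^{-1}(log|x|)^{-1-γ}`. -/
theorem fEH_tail_asymptotics (γ s : ℝ) (hγ : 0 < γ) (hs : s ∈ Set.Ioc (0:ℝ) 1) :
    Filter.Tendsto (fun x : ℝ => |x| * Real.log |x| ^ (1 + γ) * fEH γ s x)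
      (Filter.comap (fun x : ℝ => |x|) Filter.atTop)
      (nhds (s * γ / 2 ^ (1 + γ))) := by
  have h : Tendsto (fun a : ℝ => a * log a ^ (1 + γ) * fEH γ s a) atTop
      (nhds (s * γ / 2 ^ (1 + γ))) := by
    have h := ((tendsto_normal_component hγ).const_mul (1 - s)).add
      ((tendsto_scale_mixture hγ).const_mul s)
    rw [mul_zero, zero_add, ← mul_div_assoc] at h
    refine h.congr fun a => ?_
    rw [fEH]
    ring
  refine (h.comp tendsto_comap).congr fun x => ?_
  simp only [Function.comp_apply, fEH_abs]
end

section
/- The functions f₀ and f₁ satisfy: lim_{|z|→∞} f₀(z)/f₁(z) = 0 and sup_{z ∈ ℝ} f₀(z)/f₁(z) < ∞. -/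
open MeasureTheory Real Filter Set

/-- `f₀(z) = φ(z;0,1)`, the standard normal density. -/
noncomputable def f0 (z : ℝ) : ℝ := normPdf z 1

/-- `f₁(z) = ∫₀^∞ φ(z;0,u) H(u;γ) du`, the scale mixture of normals by the
`H`-distribution. -/
noncomputable def f1 (γ z : ℝ) : ℝ :=
  ∫ u in Set.Ioi (0:ℝ), normPdf z u * Hdens γ u

theorem normPdf_nonneg (z u : ℝ) : 0 ≤ normPdf z u := by
  unfold normPdf; positivity

theorem Hdens_pos {γ u : ℝ} (hγ : 0 < γ) (hu : 0 < u) : 0 < Hdens γ u := by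
  have := Real.log_nonneg (by linarith : (1 : ℝ) ≤ 1 + u)
  unfold Hdens; positivity

theorem Hdens_le_Hdens {γ u v : ℝ} (hγ : 0 < γ) (hu : 0 < u) (huv : u ≤ v) :
    Hdens γ v ≤ Hdens γ u := by
  have := Real.log_nonneg (by linarith : (1 : ℝ) ≤ 1 + u)
  unfold Hdens
  gcongr
  linarith

theorem exp_mul_le_normPdf {z u : ℝ} (h2 : 2 ≤ u) (h3 : u ≤ 3) :
    (Real.sqrt (2 * Real.pi * 3))⁻¹ * Real.exp (-(z ^ 2) / 4) ≤ normPdf z u := by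
  have h : -(z ^ 2) / 4 ≤ -(z ^ 2) / (2 * u) := by
    rw [neg_div, neg_div]
    have : z ^ 2 / (2 * u) ≤ z ^ 2 / 4 := by gcongr; linarith
    linarith
  unfold normPdf
  gcongr

/-- Keeping only the part `u ∈ [2, 3]` of the mixture bounds `f₁` from below. -/
theorem exp_mul_le_f1 {γ z : ℝ} (hγ : 0 < γ)
    (hint : IntegrableOn (fun u => normPdf z u * Hdens γ u) (Set.Ioi 0)) :
    (Real.sqrt (2 * Real.pi * 3))⁻¹ * Real.exp (-(z ^ 2) / 4) * Hdens γ 3 ≤ f1 γ z := by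
  have hsub : Set.Icc (2 : ℝ) 3 ⊆ Set.Ioi 0 := fun u hu => by
    simp only [Set.mem_Ioi]; linarith [hu.1]
  calc _ = ∫ _ in Set.Icc (2 : ℝ) 3,
        (Real.sqrt (2 * Real.pi * 3))⁻¹ * Real.exp (-(z ^ 2) / 4) * Hdens γ 3 := by
        rw [setIntegral_const]; norm_num [Measure.real]
    _ ≤ ∫ u in Set.Icc (2 : ℝ) 3, normPdf z u * Hdens γ u := by
        refine setIntegral_mono_on (integrableOn_const measure_Icc_lt_top.ne) (hint.mono_set hsub) measurableSet_Icc ?_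
        intro u hu
        exact mul_le_mul (exp_mul_le_normPdf hu.1 hu.2)
          (Hdens_le_Hdens hγ (hsub hu) hu.2) (Hdens_pos hγ (by norm_num)).le
          (normPdf_nonneg z u)
    _ ≤ f1 γ z := by
        refine setIntegral_mono_set hint ?_ hsub.eventuallyLE
        filter_upwards [ae_restrict_mem measurableSet_Ioi] with u hu
        exact mul_nonneg (normPdf_nonneg z u) (Hdens_pos hγ hu).le

theorem f1_nonneg {γ : ℝ} (hγ : 0 < γ) (z : ℝ) : 0 ≤ f1 γ z :=
  setIntegral_nonneg measurableSet_Ioi fun u hu =>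
    mul_nonneg (normPdf_nonneg z u) (Hdens_pos hγ hu).le

theorem exists_f0_div_f1_le {γ : ℝ} (hγ : 0 < γ) :
    ∃ C, 0 ≤ C ∧ ∀ z, f0 z / f1 γ z ≤ C * Real.exp (-(z ^ 2) / 4) := by
  have hH : 0 < Hdens γ 3 := Hdens_pos hγ (by norm_num)
  have hpi := Real.pi_pos
  have hK : 0 < (Real.sqrt (2 * Real.pi * 3))⁻¹ * Hdens γ 3 := by positivity
  refine ⟨(Real.sqrt (2 * Real.pi * 1))⁻¹ / ((Real.sqrt (2 * Real.pi * 3))⁻¹ * Hdens γ 3),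
    by positivity, fun z => ?_⟩
  by_cases hint : IntegrableOn (fun u => normPdf z u * Hdens γ u) (Set.Ioi 0)
  · have hlow := exp_mul_le_f1 hγ hint
    have hE := Real.exp_pos (-(z ^ 2) / 4)
    have hpos : 0 < f1 γ z := lt_of_lt_of_le (by positivity) hlow
    have hf0 : f0 z = (Real.sqrt (2 * Real.pi * 1))⁻¹ *
        (Real.exp (-(z ^ 2) / 4) * Real.exp (-(z ^ 2) / 4)) := by
      rw [← Real.exp_add, f0, normPdf]; congr 2; ring
    rw [div_le_iff₀ hpos]
    calc f0 z = (Real.sqrt (2 * Real.pi * 1))⁻¹ / ((Real.sqrt (2 * Real.pi * 3))⁻¹ * Hdens γ 3) *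
          Real.exp (-(z ^ 2) / 4) *
          ((Real.sqrt (2 * Real.pi * 3))⁻¹ * Real.exp (-(z ^ 2) / 4) * Hdens γ 3) := by
          rw [hf0]; field_simp
      _ ≤ _ := by gcongr
  · have h0 : f1 γ z = 0 := integral_undef hint
    rw [h0, div_zero]
    positivity

/-- `f₀(z)/f₁(z) → 0` as `|z| → ∞`, and `sup_{z ∈ ℝ} f₀(z)/f₁(z) < ∞`. -/
theorem f0_div_f1_tendsto_zero_and_bounded (γ : ℝ) (hγ : 0 < γ) :
    Filter.Tendsto (fun z : ℝ => f0 z / f1 γ z)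
        (Filter.comap (fun z : ℝ => |z|) Filter.atTop) (nhds 0) ∧
      BddAbove (Set.range fun z : ℝ => f0 z / f1 γ z) := by
  obtain ⟨C, hC, hle⟩ := exists_f0_div_f1_le hγ
  have hnn : ∀ z, 0 ≤ f0 z / f1 γ z := fun z => div_nonneg (normPdf_nonneg z 1) (f1_nonneg hγ z)
  constructor
  · refine squeeze_zero hnn hle ?_
    have hexp : Tendsto (fun x : ℝ => C * Real.exp (-(x ^ 2) / 4)) atTop (nhds 0) := by
      rw [← mul_zero C]
      refine (Real.tendsto_exp_atBot.comp ?_).const_mul C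
      exact (tendsto_neg_atTop_atBot.comp (tendsto_pow_atTop two_ne_zero)).atBot_div_const
        (by norm_num)
    simpa [Function.comp_def] using
      hexp.comp (tendsto_comap : Tendsto (fun z : ℝ => |z|) (comap _ atTop) atTop)
  · refine ⟨C, ?_⟩
    rintro _ ⟨z, rfl⟩
    refine (hle z).trans (mul_le_of_le_one_right hC (Real.exp_le_one_iff.2 ?_))
    rw [neg_div]
    exact neg_nonpos.2 (by positivity)
end

section
/- There exists a constant C₃ > 0 such that for all z ∈ ℝ, f₁(z) ≤ C₃/(1+|z|). -/
open MeasureTheory Real Filter Set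

theorem Hdens_nonneg {γ u : ℝ} (hγ : 0 < γ) (hu : 0 < u) : 0 ≤ Hdens γ u := by
  have hlog : 0 ≤ Real.log (1 + u) := Real.log_nonneg (by linarith)
  unfold Hdens
  positivity

theorem Hdens_le {γ u : ℝ} (hγ : 0 < γ) (hu : 0 < u) : Hdens γ u ≤ γ := by
  have hlog : 0 ≤ Real.log (1 + u) := Real.log_nonneg (by linarith)
  refine div_le_self hγ.le (one_le_mul_of_one_le_of_one_le (by linarith) ?_)
  exact Real.one_le_rpow (by linarith) (by linarith)

theorem measurable_Hdens (γ : ℝ) : Measurable (Hdens γ) := by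
  unfold Hdens
  fun_prop

theorem integrableOn_Hdens {γ : ℝ} (hγ : 0 < γ) : IntegrableOn (Hdens γ) (Ioi 0) := by
  have hderiv : ∀ u ∈ Ici (0 : ℝ),
      HasDerivAt (fun u : ℝ => -(1 + Real.log (1 + u)) ^ (-γ)) (Hdens γ u) u := by
    intro u hu
    have hu : 0 ≤ u := hu
    have hlog : 0 ≤ Real.log (1 + u) := Real.log_nonneg (by linarith)
    have h1 : HasDerivAt (fun u : ℝ => 1 + Real.log (1 + u)) (1 / (1 + u)) u :=
      (((hasDerivAt_id u).const_add 1).log (by simp only [id]; linarith)).const_add 1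
    refine (h1.rpow_const (p := -γ) (Or.inl (by linarith))).neg.congr_deriv ?_
    rw [Hdens, show -γ - 1 = -(1 + γ) by ring, Real.rpow_neg (by linarith)]
    field_simp
  have hlim : Tendsto (fun u : ℝ => -(1 + Real.log (1 + u)) ^ (-γ)) atTop (nhds (-0)) := by
    refine ((tendsto_rpow_neg_atTop hγ).comp ?_).neg
    exact tendsto_atTop_add_const_left _ _
      (Real.tendsto_log_atTop.comp (tendsto_atTop_add_const_left _ _ tendsto_id))
  exact integrableOn_Ioi_deriv_of_nonneg' hderiv (fun u hu => Hdens_nonneg hγ hu) hlim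

theorem integrableOn_inv_sqrt_mul_Hdens {γ : ℝ} (hγ : 0 < γ) :
    IntegrableOn (fun u => (√u)⁻¹ * Hdens γ u) (Ioi 0) := by
  have hmeas : Measurable fun u => (√u)⁻¹ * Hdens γ u :=
    Real.continuous_sqrt.measurable.inv.mul (measurable_Hdens γ)
  rw [← Ioc_union_Ioi_eq_Ioi zero_le_one]
  refine IntegrableOn.union ?_ ?_
  · have hpow : IntegrableOn (fun u : ℝ => u ^ (-(1 / 2) : ℝ)) (Ioc 0 1) :=
      (intervalIntegrable_iff_integrableOn_Ioc_of_le zero_le_one).1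
        (intervalIntegral.intervalIntegrable_rpow' (by norm_num))
    refine (hpow.mul_const γ).mono' hmeas.aestronglyMeasurable ?_
    filter_upwards [ae_restrict_mem measurableSet_Ioc] with u hu
    rw [Real.norm_of_nonneg (mul_nonneg (by positivity) (Hdens_nonneg hγ hu.1)),
      Real.rpow_neg hu.1.le, ← Real.sqrt_eq_rpow]
    exact mul_le_mul_of_nonneg_left (Hdens_le hγ hu.1) (by positivity)
  · refine ((integrableOn_Hdens hγ).mono_set (Ioi_subset_Ioi zero_le_one)).mono'
      hmeas.aestronglyMeasurable ?_
    filter_upwards [ae_restrict_mem measurableSet_Ioi] with u hu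
    have hu1 : 1 < u := hu
    have hH := Hdens_nonneg hγ (zero_lt_one.trans hu1)
    rw [Real.norm_of_nonneg (mul_nonneg (by positivity) hH)]
    exact mul_le_of_le_one_left hH (inv_le_one_of_one_le₀ (Real.one_le_sqrt.2 hu1.le))

theorem one_add_abs_mul_normPdf_le (z : ℝ) {u : ℝ} (hu : 0 < u) :
    (1 + |z|) * normPdf z u ≤ 1 + (√u)⁻¹ := by
  have hs : 0 < √u := Real.sqrt_pos.2 hu
  have hle : normPdf z u ≤ (√u)⁻¹ * Real.exp (-(z ^ 2) / (2 * u)) := by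
    unfold normPdf
    gcongr
    nlinarith [Real.pi_gt_three]
  have hexp : Real.exp (-(z ^ 2) / (2 * u)) ≤ 1 := Real.exp_le_one_iff.2
    (div_nonpos_of_nonpos_of_nonneg (by nlinarith [sq_nonneg z]) (by linarith))
  have hx : |z| * (√u)⁻¹ ≤ Real.exp ((|z| * (√u)⁻¹) ^ 2 / 2) := by
    nlinarith [Real.add_one_le_exp ((|z| * (√u)⁻¹) ^ 2 / 2), sq_nonneg (|z| * (√u)⁻¹ - 1)]
  have hz : |z| * (√u)⁻¹ * Real.exp (-(z ^ 2) / (2 * u)) ≤ 1 := by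
    have harg : -(z ^ 2) / (2 * u) = -((|z| * (√u)⁻¹) ^ 2 / 2) := by
      rw [mul_pow, sq_abs, inv_pow, Real.sq_sqrt hu.le]
      field_simp
    rw [harg, Real.exp_neg]
    exact mul_inv_le_one_of_le₀ hx (Real.exp_pos _).le
  calc (1 + |z|) * normPdf z u
      ≤ (1 + |z|) * ((√u)⁻¹ * Real.exp (-(z ^ 2) / (2 * u))) := by gcongr
    _ = |z| * (√u)⁻¹ * Real.exp (-(z ^ 2) / (2 * u))
        + (√u)⁻¹ * Real.exp (-(z ^ 2) / (2 * u)) := by ring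
    _ ≤ 1 + (√u)⁻¹ := add_le_add hz (mul_le_of_le_one_right (by positivity) hexp)

/-- There is `C₃ > 0` such that `f₁(z) ≤ C₃/(1+|z|)` for all `z ∈ ℝ`. -/
theorem f1_upper_bound_linear (γ : ℝ) (hγ : 0 < γ) :
    ∃ C₃ > (0:ℝ), ∀ z : ℝ, f1 γ z ≤ C₃ / (1 + |z|) := by
  have hint : IntegrableOn (fun u => (1 + (√u)⁻¹) * Hdens γ u) (Ioi 0) := by
    simp only [add_mul, one_mul]
    exact (integrableOn_Hdens hγ).add (integrableOn_inv_sqrt_mul_Hdens hγ)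
  have hnonneg : 0 ≤ ∫ u in Ioi (0 : ℝ), (1 + (√u)⁻¹) * Hdens γ u :=
    setIntegral_nonneg measurableSet_Ioi fun u hu =>
      mul_nonneg (by positivity) (Hdens_nonneg hγ hu)
  refine ⟨(∫ u in Ioi (0 : ℝ), (1 + (√u)⁻¹) * Hdens γ u) + 1, by linarith, fun z => ?_⟩
  have hz : 0 < 1 + |z| := by positivity
  rw [le_div_iff₀' hz, f1, ← integral_const_mul]
  refine (integral_mono_of_nonneg ?_ hint ?_).trans (le_add_of_nonneg_right zero_le_one)
  · filter_upwards [ae_restrict_mem measurableSet_Ioi] with u hu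
    exact mul_nonneg hz.le (mul_nonneg (normPdf_nonneg z u) (Hdens_nonneg hγ hu))
  · filter_upwards [ae_restrict_mem measurableSet_Ioi] with u hu
    rw [← mul_assoc]
    exact mul_le_mul_of_nonneg_right (one_add_abs_mul_normPdf_le z hu) (Hdens_nonneg hγ hu)
end

section
/- Let m, p ∈ ℕ with m ≥ p, let w = (w₁,…,w_m) ∈ ℝ^m, and let z₁,…,z_m ∈ ℝ^p be row vectors such that every set of p distinct vectors among z₁,…,z_m is linearly independent. Then there exist R > 0 and δ > 0 (depending on w and z₁,…,z_m) such that for all β ∈ ℝ^p with ‖β‖ ≥ R, ∏_{i=1}^m 1/(1 + |w_i − z_iᵀβ|) ≤ 1/(1 + δ‖β‖)^{m−p+1}. -/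
open Real Finset
open scoped RealInnerProductSpace BigOperators

/-- A linearly independent family of `finrank ℝ E` vectors bounds the norm from below: some
inner product against the family is comparable to the norm. -/
theorem exists_pos_forall_exists_mul_norm_le_abs_inner {E ι : Type*} [NormedAddCommGroup E]
    [InnerProductSpace ℝ E] [FiniteDimensional ℝ E] [Fintype ι] (v : ι → E)
    (hv : LinearIndependent ℝ v) (hcard : Fintype.card ι = Module.finrank ℝ E) :
    ∃ c > (0 : ℝ), ∀ x : E, x ≠ 0 → ∃ i, c * ‖x‖ ≤ |⟪v i, x⟫| := by
  let L : E →ₗ[ℝ] (ι → ℝ) := LinearMap.pi fun i => (innerSL ℝ (v i)).toLinearMap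
  have hL : ∀ x i, L x i = ⟪v i, x⟫ := fun x i => rfl
  have hker : LinearMap.ker L = ⊥ := by
    rw [LinearMap.ker_eq_bot']
    intro x hx
    have hspan : x ∈ Submodule.span ℝ (Set.range v) := by
      rw [hv.span_eq_top_of_card_eq_finrank' hcard]
      trivial
    have horth : ∀ y ∈ Submodule.span ℝ (Set.range v), ⟪y, x⟫ = 0 := by
      intro y hy
      induction hy using Submodule.span_induction with
      | mem y hy =>
        obtain ⟨i, rfl⟩ := hy
        rw [← hL, hx, Pi.zero_apply]
      | zero => exact inner_zero_left x
      | add y z _ _ hy hz => rw [inner_add_left, hy, hz, add_zero]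
      | smul a y _ hy => rw [real_inner_smul_left, hy, mul_zero]
    exact inner_self_eq_zero.1 (horth x hspan)
  obtain ⟨K, hK, hLK⟩ := L.exists_antilipschitzWith hker
  have hK' : (0 : ℝ) < K := hK
  refine ⟨(K : ℝ)⁻¹, inv_pos.2 hK', fun x hx => ?_⟩
  by_contra! hlt
  have hpos : 0 < (K : ℝ)⁻¹ * ‖x‖ := mul_pos (inv_pos.2 hK') (norm_pos_iff.2 hx)
  have hnorm : ‖L x‖ < (K : ℝ)⁻¹ * ‖x‖ := (pi_norm_lt_iff hpos).2 hlt
  have hle : ‖x‖ ≤ K * ‖L x‖ := by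
    simpa [dist_eq_norm] using hLK.le_mul_dist x 0
  rw [inv_mul_eq_div, lt_div_iff₀ hK'] at hnorm
  linarith

/-- If any `p` distinct rows among `z₁,…,z_m ∈ ℝ^p` are linearly independent and
`m ≥ p`, then there exist `R > 0` and `δ > 0` such that for every `β` with
`‖β‖ ≥ R`, `∏ᵢ (1 + |wᵢ - zᵢᵀβ|)⁻¹ ≤ (1 + δ‖β‖)^{-(m-p+1)}`. -/
theorem finite_product_linear_bound (m p : ℕ) (hmp : p ≤ m)
    (w : Fin m → ℝ) (z : Fin m → EuclideanSpace ℝ (Fin p))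
    (hz : ∀ s : Finset (Fin m), s.card = p → LinearIndependent ℝ (fun i : s => z i)) :
    ∃ R > (0:ℝ), ∃ δ > (0:ℝ), ∀ β : EuclideanSpace ℝ (Fin p), R ≤ ‖β‖ →
      (∏ i : Fin m, (1 + |w i - ⟪z i, β⟫|)⁻¹) ≤
        ((1 + δ * ‖β‖) ^ (m - p + 1))⁻¹ := by
  obtain ⟨c, hc, hc0⟩ : ∃ c : ℝ, (∀ s : Finset (Fin m), s.card = p →
      ∀ x : EuclideanSpace ℝ (Fin p), x ≠ 0 → ∃ i ∈ s, c * ‖x‖ ≤ |⟪z i, x⟫|) ∧ 0 < c := by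
    refine Filter.Eventually.exists (f := nhdsWithin 0 (Set.Ioi 0))
      (Filter.Eventually.and (Filter.eventually_all.2 fun s => ?_) self_mem_nhdsWithin)
    by_cases hs : s.card = p
    · obtain ⟨c, hc0, hc⟩ := exists_pos_forall_exists_mul_norm_le_abs_inner _ (hz s hs)
        (by simpa using hs)
      filter_upwards [Ioc_mem_nhdsGT hc0] with d hd _ x hx
      obtain ⟨i, hi⟩ := hc x hx
      exact ⟨i, i.2, (mul_le_mul_of_nonneg_right hd.2 (norm_nonneg x)).trans hi⟩
    · exact Filter.Eventually.of_forall fun _ h => absurd h hs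
  have hW : ∀ i, |w i| ≤ ∑ j, |w j| := fun i =>
    single_le_sum (f := fun j => |w j|) (fun j _ => abs_nonneg _) (mem_univ i)
  have hW0 : 0 ≤ ∑ j, |w j| := sum_nonneg fun j _ => abs_nonneg _
  refine ⟨1 + (∑ j, |w j|) / (c / 2), by positivity, c / 2, by positivity, fun β hβ => ?_⟩
  have hβ1 : 1 ≤ ‖β‖ := le_trans (le_add_of_nonneg_right (by positivity)) hβ
  have hβ0 : β ≠ 0 := norm_pos_iff.1 (by linarith)
  have hβW : ∑ j, |w j| ≤ c / 2 * ‖β‖ := by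
    rw [mul_comm, ← div_le_iff₀ (by positivity)]
    linarith
  let good : Finset (Fin m) := univ.filter fun i => c * ‖β‖ ≤ |⟪z i, β⟫|
  have hcard : m - p + 1 ≤ good.card := by
    by_contra! hlt
    have hcompl : p ≤ goodᶜ.card := by
      rw [card_compl, Fintype.card_fin]
      omega
    obtain ⟨s, hs, hsp⟩ := exists_subset_card_eq hcompl
    obtain ⟨i, hi, hi'⟩ := hc s hsp β hβ0
    exact mem_compl.1 (hs hi) (mem_filter.2 ⟨mem_univ i, hi'⟩)
  have hgood : ∀ i ∈ good, 1 + c / 2 * ‖β‖ ≤ 1 + |w i - ⟪z i, β⟫| := by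
    intro i hi
    have h1 : c * ‖β‖ ≤ |⟪z i, β⟫| := (mem_filter.1 hi).2
    have h2 := abs_sub_abs_le_abs_sub ⟪z i, β⟫ (w i)
    rw [abs_sub_comm] at h2
    linarith [hW i]
  rw [prod_inv_distrib]
  refine inv_anti₀ (by positivity) ?_
  calc (1 + c / 2 * ‖β‖) ^ (m - p + 1)
      ≤ (1 + c / 2 * ‖β‖) ^ good.card :=
        pow_le_pow_right₀ (le_add_of_nonneg_right (by positivity)) hcard
    _ = ∏ _i ∈ good, (1 + c / 2 * ‖β‖) := (prod_const _).symm
    _ ≤ ∏ i ∈ good, (1 + |w i - ⟪z i, β⟫|) := prod_le_prod (fun _ _ => by positivity) hgood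
    _ ≤ ∏ i, (1 + |w i - ⟪z i, β⟫|) :=
        prod_le_prod_of_subset_of_one_le (subset_univ _) (fun _ _ => by positivity)
          fun i _ _ => le_add_of_nonneg_right (abs_nonneg _)
end

section
/- Fix γ > 0 and s ∈ (0,1], and let f(z) = (1-s)·φ(z;0,1) + s·∫₀^∞ φ(z;0,u)·H(u;γ) du. Fix a ∈ ℝ, b ≠ 0, μ ∈ ℝ and σ > 0. Then lim_{ω→∞} f((a + b·ω − μ)/σ) / (σ·f(a + b·ω)) = 1. -/
open MeasureTheory Real Filter Set

lemma normPdf_pos {z u : ℝ} (hu : 0 < u) : 0 < normPdf z u := by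
  unfold normPdf
  positivity

/-- The scaling relation of the centred normal densities. -/
lemma normPdf_sq_mul {x : ℝ} (hx : 0 < x) (v : ℝ) :
    normPdf x (x ^ 2 * v) = x⁻¹ * normPdf 1 v := by
  unfold normPdf
  have h1 : 2 * Real.pi * (x ^ 2 * v) = x ^ 2 * (2 * Real.pi * v) := by ring
  have h2 : -(x ^ 2) / (2 * (x ^ 2 * v)) = -(1 ^ 2) / (2 * v) := by
    rcases eq_or_ne v 0 with rfl | hv
    · simp
    · field_simp
  rw [h1, h2, Real.sqrt_mul (sq_nonneg x), Real.sqrt_sq hx.le, mul_inv]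
  ring

/-- The `H`-density at `x ^ 2 * v`, rescaled by `x ^ 2 * (1 + log (1 + x ^ 2)) ^ (1 + γ)`. -/
noncomputable def scaledHdens (γ x v : ℝ) : ℝ :=
  γ * (x ^ 2 / (1 + x ^ 2 * v)) *
    ((1 + Real.log (1 + x ^ 2)) / (1 + Real.log (1 + x ^ 2 * v))) ^ (1 + γ)

lemma one_le_one_add_log {t : ℝ} (ht : 0 ≤ t) : 1 ≤ 1 + Real.log (1 + t) := by
  have := Real.log_nonneg (by linarith : (1:ℝ) ≤ 1 + t)
  linarith

lemma mul_integral_eq_integral_scaledHdens (γ : ℝ) {x : ℝ} (hx : 0 < x) :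
    x * (1 + Real.log (1 + x ^ 2)) ^ (1 + γ) *
        ∫ u in Set.Ioi (0:ℝ), normPdf x u * Hdens γ u =
      ∫ v in Set.Ioi (0:ℝ), normPdf 1 v * scaledHdens γ x v := by
  have hx2 : 0 < x ^ 2 := by positivity
  have h := integral_comp_mul_left_Ioi (fun u => normPdf x u * Hdens γ u) 0 hx2
  rw [mul_zero, smul_eq_mul] at h
  have h' : (∫ u in Set.Ioi (0:ℝ), normPdf x u * Hdens γ u) =
      x ^ 2 * ∫ v in Set.Ioi (0:ℝ), normPdf x (x ^ 2 * v) * Hdens γ (x ^ 2 * v) := by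
    rw [h, mul_inv_cancel_left₀ hx2.ne']
  rw [h', ← mul_assoc, ← integral_const_mul]
  refine setIntegral_congr_fun measurableSet_Ioi fun v hv => ?_
  have hv : 0 < v := hv
  have hL := one_le_one_add_log hx2.le
  have hLv := one_le_one_add_log (mul_pos hx2 hv).le
  have hpow : (1 + Real.log (1 + x ^ 2 * v)) ^ (1 + γ) ≠ 0 :=
    (Real.rpow_pos_of_pos (by linarith) _).ne'
  have h1 : 1 + x ^ 2 * v ≠ 0 := by positivity
  simp only [scaledHdens, Hdens]
  rw [normPdf_sq_mul hx, Real.div_rpow (by linarith) (by linarith)]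
  field_simp

/-- Quantities of the same order have asymptotically equal logarithms. -/
lemma tendsto_one_add_log_div {ι : Type*} {l : Filter ι} {p q : ι → ℝ} {r : ℝ} (hr : 0 < r)
    (hp : Tendsto p l atTop) (hqp : Tendsto (fun i => q i / p i) l (nhds r)) :
    Tendsto (fun i => (1 + Real.log (q i)) / (1 + Real.log (p i))) l (nhds 1) := by
  have hlog : Tendsto (fun i => 1 + Real.log (p i)) l atTop :=
    tendsto_atTop_add_const_left _ _ (Real.tendsto_log_atTop.comp hp)
  have h0 : Tendsto (fun i => Real.log (q i / p i) / (1 + Real.log (p i))) l (nhds 0) :=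
    (hqp.log hr.ne').div_atTop hlog
  have h1 := h0.const_add 1
  rw [add_zero] at h1
  refine h1.congr' ?_
  filter_upwards [hp.eventually_gt_atTop 0, hlog.eventually_gt_atTop 0,
    hqp.eventually (lt_mem_nhds hr)] with i hpi hli hqi
  have hq : 0 < q i := by
    have := mul_pos hqi hpi
    rwa [div_mul_cancel₀ _ hpi.ne'] at this
  rw [Real.log_div hq.ne' hpi.ne']
  field_simp
  ring

lemma tendsto_scaledHdens (γ : ℝ) {v : ℝ} (hv : 0 < v) :
    Tendsto (fun x => scaledHdens γ x v) atTop (nhds (γ * v⁻¹)) := by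
  have hsq : Tendsto (fun x : ℝ => x ^ 2) atTop atTop := tendsto_pow_atTop two_ne_zero
  have hp : Tendsto (fun x : ℝ => 1 + x ^ 2 * v) atTop atTop :=
    tendsto_atTop_add_const_left _ _ (hsq.atTop_mul_const hv)
  have hinv : Tendsto (fun x : ℝ => (1 + x ^ 2 * v)⁻¹) atTop (nhds 0) :=
    tendsto_inv_atTop_zero.comp hp
  have h1 : Tendsto (fun x : ℝ => x ^ 2 / (1 + x ^ 2 * v)) atTop (nhds v⁻¹) := by
    have := (hinv.const_sub 1).const_mul v⁻¹
    rw [sub_zero, mul_one] at this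
    refine this.congr fun x => ?_
    have : 1 + x ^ 2 * v ≠ 0 := by positivity
    field_simp
    ring
  have h2 : Tendsto (fun x : ℝ => (1 + x ^ 2) / (1 + x ^ 2 * v)) atTop (nhds v⁻¹) := by
    have := hinv.add h1
    rw [zero_add] at this
    refine this.congr fun x => ?_
    ring
  have h3 := (tendsto_one_add_log_div (inv_pos.2 hv) hp h2).rpow_const
    (p := 1 + γ) (Or.inl one_ne_zero)
  rw [Real.one_rpow] at h3
  simpa [scaledHdens] using (h1.const_mul γ).mul h3

lemma scaledHdens_nonneg {γ x v : ℝ} (hγ : 0 < γ) (hv : 0 < v) : 0 ≤ scaledHdens γ x v := by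
  have h1 := one_le_one_add_log (sq_nonneg x)
  have h2 := one_le_one_add_log (mul_nonneg (sq_nonneg x) hv.le)
  unfold scaledHdens
  have : 0 ≤ (1 + Real.log (1 + x ^ 2)) / (1 + Real.log (1 + x ^ 2 * v)) :=
    div_nonneg (by linarith) (by linarith)
  positivity

lemma scaledHdens_le {γ v : ℝ} (x : ℝ) (hγ : 0 < γ) (hv : 0 < v) :
    scaledHdens γ x v ≤ γ * v⁻¹ * (1 + v⁻¹ ^ (1 + γ)) := by
  have hx : 0 ≤ x ^ 2 * v := by positivity
  have h1 := one_le_one_add_log (sq_nonneg x)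
  have h2 := one_le_one_add_log hx
  have hA : x ^ 2 / (1 + x ^ 2 * v) ≤ v⁻¹ := by
    rw [div_le_iff₀ (by positivity), mul_add, mul_one]
    have : v⁻¹ * (x ^ 2 * v) = x ^ 2 := by field_simp
    have := inv_pos.2 hv
    linarith
  have hR0 : 0 ≤ (1 + Real.log (1 + x ^ 2)) / (1 + Real.log (1 + x ^ 2 * v)) :=
    div_nonneg (by linarith) (by linarith)
  have hB : ((1 + Real.log (1 + x ^ 2)) / (1 + Real.log (1 + x ^ 2 * v))) ^ (1 + γ) ≤
      1 + v⁻¹ ^ (1 + γ) := by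
    rcases le_total 1 v with h | h
    · have hle : (1 + Real.log (1 + x ^ 2)) / (1 + Real.log (1 + x ^ 2 * v)) ≤ 1 := by
        rw [div_le_one (by linarith)]
        gcongr
        nlinarith [sq_nonneg x]
      have := Real.rpow_le_one hR0 hle (by linarith : 0 ≤ 1 + γ)
      have : 0 ≤ v⁻¹ ^ (1 + γ) := by positivity
      linarith
    · have hle : (1 + Real.log (1 + x ^ 2)) / (1 + Real.log (1 + x ^ 2 * v)) ≤ v⁻¹ := by
        have hi : 1 ≤ v⁻¹ := (one_le_inv₀ hv).2 h
        have hlog : Real.log (1 + x ^ 2) ≤ Real.log (1 + x ^ 2 * v) + Real.log v⁻¹ := by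
          rw [← Real.log_mul (by positivity) (by positivity)]
          refine Real.log_le_log (by positivity) ?_
          have : (1 + x ^ 2 * v) * v⁻¹ = v⁻¹ + x ^ 2 := by field_simp
          linarith
        have hlv := Real.log_le_sub_one_of_pos (inv_pos.2 hv)
        rw [div_le_iff₀ (by linarith)]
        nlinarith
      have := Real.rpow_le_rpow hR0 hle (by linarith : 0 ≤ 1 + γ)
      linarith
  unfold scaledHdens
  have := Real.rpow_nonneg hR0 (1 + γ)
  gcongr

/-- Negative moments of the inverse-gamma type weight are finite. -/
lemma integrableOn_normPdf_one_mul_rpow {p : ℝ} (hp : 1 ≤ p) :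
    IntegrableOn (fun v => normPdf 1 v * v⁻¹ ^ p) (Set.Ioi 0) := by
  have h1 : IntegrableOn (fun w : ℝ => w ^ (p - 3 / 2) * Real.exp (-(1 / 2) * w)) (Set.Ioi 0) :=
    integrableOn_rpow_mul_exp_neg_mul_rpow (p := 1) (s := p - 3 / 2) (b := 1 / 2)
      (by linarith) one_pos (by norm_num) |>.congr_fun (fun w _ => by simp) measurableSet_Ioi
  have h2 := (integrableOn_Ioi_comp_rpow_iff _ (by norm_num : (-1:ℝ) ≠ 0)).2 h1
  refine IntegrableOn.congr_fun (h2.const_mul (Real.sqrt (2 * Real.pi))⁻¹) (fun v hv => ?_)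
    measurableSet_Ioi
  have hv : 0 < v := hv
  have e1 : v ^ (-1 - 1 : ℝ) = v⁻¹ ^ (2 : ℝ) := by
    rw [Real.inv_rpow hv.le, ← Real.rpow_neg hv.le]; norm_num
  have e2 : v ^ (-1 : ℝ) = v⁻¹ := Real.rpow_neg_one v
  have e3 : (Real.sqrt v)⁻¹ = v⁻¹ ^ (1 / 2 : ℝ) := by
    rw [Real.sqrt_eq_rpow, Real.inv_rpow hv.le]
  have hvi := inv_pos.2 hv
  have e4 : v⁻¹ ^ (2 : ℝ) * v⁻¹ ^ (p - 3 / 2) = v⁻¹ ^ (1 / 2 : ℝ) * v⁻¹ ^ p := by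
    rw [← Real.rpow_add hvi, ← Real.rpow_add hvi]; ring_nf
  have e5 : -(1 / 2) * v⁻¹ = -(1 ^ 2) / (2 * v) := by field_simp
  simp only [normPdf, smul_eq_mul]
  rw [e1, e2, e5, Real.sqrt_mul (by positivity : 0 ≤ 2 * Real.pi) v, mul_inv, e3]
  simp only [abs_neg, abs_one, one_mul]
  linear_combination (Real.sqrt (2 * Real.pi))⁻¹ * Real.exp (-(1 ^ 2) / (2 * v)) * e4

lemma tendsto_integral_scaledHdens {γ : ℝ} (hγ : 0 < γ) :
    Tendsto (fun x => ∫ v in Set.Ioi (0:ℝ), normPdf 1 v * scaledHdens γ x v) atTop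
      (nhds (∫ v in Set.Ioi (0:ℝ), normPdf 1 v * (γ * v⁻¹))) := by
  refine tendsto_integral_filter_of_dominated_convergence
    (fun v => normPdf 1 v * (γ * v⁻¹ * (1 + v⁻¹ ^ (1 + γ)))) ?_ ?_ ?_ ?_
  · refine Eventually.of_forall fun x => Measurable.aestronglyMeasurable ?_
    unfold normPdf scaledHdens
    fun_prop
  · refine Eventually.of_forall fun x => ?_
    filter_upwards [ae_restrict_mem measurableSet_Ioi] with v hv
    have hv : 0 < v := hv
    have h := normPdf_pos (z := 1) hv
    rw [Real.norm_of_nonneg (mul_nonneg h.le (scaledHdens_nonneg hγ hv))]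
    exact mul_le_mul_of_nonneg_left (scaledHdens_le x hγ hv) h.le
  · have h1 := (integrableOn_normPdf_one_mul_rpow le_rfl).const_mul γ
    have h2 := (integrableOn_normPdf_one_mul_rpow (p := 2 + γ) (by linarith)).const_mul γ
    refine IntegrableOn.congr_fun (h1.add h2) (fun v hv => ?_) measurableSet_Ioi
    have hvi : 0 < v⁻¹ := inv_pos.2 hv
    have e : v⁻¹ ^ (2 + γ) = v⁻¹ * v⁻¹ ^ (1 + γ) := by
      rw [show 2 + γ = 1 + (1 + γ) by ring, Real.rpow_add hvi 1, Real.rpow_one]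
    simp only [Pi.add_apply, e, Real.rpow_one]
    ring
  · filter_upwards [ae_restrict_mem measurableSet_Ioi] with v hv
    exact (tendsto_scaledHdens γ hv).const_mul _

lemma integral_normPdf_one_mul_inv_pos {γ : ℝ} (hγ : 0 < γ) :
    0 < ∫ v in Set.Ioi (0:ℝ), normPdf 1 v * (γ * v⁻¹) := by
  have hpos : ∀ v ∈ Set.Ioi (0:ℝ), 0 < normPdf 1 v * (γ * v⁻¹) := fun v hv =>
    mul_pos (normPdf_pos hv) (mul_pos hγ (inv_pos.2 hv))
  rw [setIntegral_pos_iff_support_of_nonneg_ae]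
  · have : Function.support (fun v => normPdf 1 v * (γ * v⁻¹)) ∩ Set.Ioi 0 = Set.Ioi 0 :=
      Set.inter_eq_right.2 fun v hv => (hpos v hv).ne'
    rw [this, Real.volume_Ioi]
    exact ENNReal.zero_lt_top
  · filter_upwards [ae_restrict_mem measurableSet_Ioi] with v hv
    exact (hpos v hv).le
  · refine IntegrableOn.congr_fun ((integrableOn_normPdf_one_mul_rpow le_rfl).const_mul γ)
      (fun v _ => ?_) measurableSet_Ioi
    simp only [Real.rpow_one]
    ring

lemma tendsto_mul_normPdf_one {γ : ℝ} (hγ : 0 < γ) :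
    Tendsto (fun x => x * (1 + Real.log (1 + x ^ 2)) ^ (1 + γ) * normPdf x 1) atTop
      (nhds 0) := by
  have ht : Tendsto (fun x : ℝ => 1 + x ^ 2) atTop atTop :=
    tendsto_atTop_add_const_left _ _ (tendsto_pow_atTop two_ne_zero)
  have h := ((tendsto_rpow_mul_exp_neg_mul_atTop_nhds_zero (2 + γ) (1 / 2) (by norm_num)).comp
    ht).const_mul ((Real.sqrt (2 * Real.pi))⁻¹ * Real.exp (1 / 2))
  rw [mul_zero] at h
  refine squeeze_zero' ?_ ?_ h
  · filter_upwards [eventually_ge_atTop 0] with x hx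
    have h1 := one_le_one_add_log (sq_nonneg x)
    have := Real.rpow_nonneg (by linarith : 0 ≤ 1 + Real.log (1 + x ^ 2)) (1 + γ)
    have := (normPdf_pos (z := x) one_pos).le
    positivity
  · filter_upwards [eventually_ge_atTop 0] with x hx
    have h1 := one_le_one_add_log (sq_nonneg x)
    have ht0 : 0 < 1 + x ^ 2 := by positivity
    have hL : 1 + Real.log (1 + x ^ 2) ≤ 1 + x ^ 2 := by
      linarith [Real.log_le_sub_one_of_pos ht0]
    have hx1 : x ≤ 1 + x ^ 2 := by nlinarith [sq_nonneg (x - 1)]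
    have hpow := Real.rpow_le_rpow (by linarith) hL (by linarith : 0 ≤ 1 + γ)
    have hprod : x * (1 + Real.log (1 + x ^ 2)) ^ (1 + γ) ≤ (1 + x ^ 2) ^ (2 + γ) := by
      rw [show 2 + γ = 1 + (1 + γ) by ring, Real.rpow_add ht0 1, Real.rpow_one]
      exact mul_le_mul hx1 hpow (Real.rpow_nonneg (by linarith) _) ht0.le
    have he : Real.exp (-(x ^ 2) / 2) =
        Real.exp (1 / 2) * Real.exp (-(1 / 2) * (1 + x ^ 2)) := by
      rw [← Real.exp_add]; ring_nf
    calc x * (1 + Real.log (1 + x ^ 2)) ^ (1 + γ) * normPdf x 1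
        ≤ (1 + x ^ 2) ^ (2 + γ) * normPdf x 1 :=
          mul_le_mul_of_nonneg_right hprod (normPdf_pos one_pos).le
      _ = _ := by
          simp only [normPdf, Function.comp, mul_one, he]
          ring

/-- The tail of `fEH γ s x` is asymptotic to a positive multiple of
`1 / (x * (1 + log (1 + x ^ 2)) ^ (1 + γ))`. -/
lemma exists_tendsto_mul_fEH {γ s : ℝ} (hγ : 0 < γ) (hs : 0 < s) :
    ∃ c, 0 < c ∧ Tendsto (fun x => x * (1 + Real.log (1 + x ^ 2)) ^ (1 + γ) * fEH γ s x)
      atTop (nhds c) := by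
  refine ⟨_, mul_pos hs (integral_normPdf_one_mul_inv_pos hγ), ?_⟩
  have h := ((tendsto_mul_normPdf_one hγ).const_mul (1 - s)).add
    ((tendsto_integral_scaledHdens hγ).const_mul s)
  rw [mul_zero, zero_add] at h
  refine h.congr' ?_
  filter_upwards [eventually_gt_atTop 0] with x hx
  rw [← mul_integral_eq_integral_scaledHdens γ hx, fEH]
  ring

lemma tendsto_fEH_div_fEH {ι : Type*} {l : Filter ι} {γ s σ : ℝ} (hγ : 0 < γ) (hs : 0 < s)
    (hσ : 0 < σ) {x y : ι → ℝ} (hx : Tendsto x l atTop) (hy : Tendsto y l atTop)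
    (hyx : Tendsto (fun i => y i / x i) l (nhds σ⁻¹)) :
    Tendsto (fun i => fEH γ s (y i) / (σ * fEH γ s (x i))) l (nhds 1) := by
  obtain ⟨c, hc, hlim⟩ := exists_tendsto_mul_fEH hγ hs
  have hsqy : Tendsto (fun i => 1 + y i ^ 2) l atTop :=
    tendsto_atTop_add_const_left _ _ ((tendsto_pow_atTop two_ne_zero).comp hy)
  have hxy : Tendsto (fun i => x i / y i) l (nhds σ) := by
    have := hyx.inv₀ (inv_ne_zero hσ.ne')
    simpa using this
  have hinv : Tendsto (fun i => (1 + y i ^ 2)⁻¹) l (nhds 0) := tendsto_inv_atTop_zero.comp hsqy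
  have hsq : Tendsto (fun i => (1 + x i ^ 2) / (1 + y i ^ 2)) l (nhds (σ ^ 2)) := by
    have := hinv.add ((hxy.pow 2).mul (hinv.const_sub 1))
    rw [zero_add, sub_zero, mul_one] at this
    refine this.congr' ?_
    filter_upwards [hy.eventually_gt_atTop 0] with i hi
    field_simp
    ring
  have hL := (tendsto_one_add_log_div (by positivity) hsqy hsq).rpow_const
    (p := 1 + γ) (Or.inl one_ne_zero)
  rw [Real.one_rpow] at hL
  have hJ := (hlim.comp hy).div (hlim.comp hx) hc.ne'
  have h := (hJ.mul (hxy.mul hL)).mul_const σ⁻¹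
  rw [div_self hc.ne', mul_one, one_mul, mul_inv_cancel₀ hσ.ne'] at h
  refine h.congr' ?_
  filter_upwards [hx.eventually_gt_atTop 0, hy.eventually_gt_atTop 0] with i hxi hyi
  have h1 := one_le_one_add_log (sq_nonneg (x i))
  have h2 := one_le_one_add_log (sq_nonneg (y i))
  have hx' := (Real.rpow_pos_of_pos (by linarith : 0 < 1 + Real.log (1 + x i ^ 2)) (1 + γ)).ne'
  have hy' := (Real.rpow_pos_of_pos (by linarith : 0 < 1 + Real.log (1 + y i ^ 2)) (1 + γ)).ne'
  rw [Real.div_rpow (by linarith) (by linarith)]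
  simp only [Function.comp, Pi.div_apply]
  field_simp

/-- For an outlying observation `y = a + bω` (`b ≠ 0`) and any fixed `μ ∈ ℝ`, `σ > 0`,
`f((a + bω − μ)/σ)/(σ f(a + bω)) → 1` as `ω → ∞`. -/
theorem fEH_outlier_ratio_tendsto_one (γ s a b μ σ : ℝ) (hγ : 0 < γ)
    (hs : s ∈ Set.Ioc (0:ℝ) 1) (hb : b ≠ 0) (hσ : 0 < σ) :
    Filter.Tendsto
      (fun ω : ℝ => fEH γ s ((a + b * ω - μ) / σ) / (σ * fEH γ s (a + b * ω)))
      Filter.atTop (nhds 1) := by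
  have hlin : Tendsto (fun ω : ℝ => |a + b * ω|) atTop atTop := by
    rcases lt_or_gt_of_ne hb with h | h
    · exact tendsto_abs_atBot_atTop.comp
        (tendsto_atBot_add_const_left _ a (tendsto_id.const_mul_atTop_of_neg h))
    · exact tendsto_abs_atTop_atTop.comp
        (tendsto_atTop_add_const_left _ a (tendsto_id.const_mul_atTop h))
  have hratio : Tendsto (fun ω : ℝ => |(a + b * ω - μ) / σ| / |a + b * ω|) atTop
      (nhds σ⁻¹) := by
    have h0 : Tendsto (fun ω : ℝ => μ / (a + b * ω)) atTop (nhds 0) := by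
      rw [tendsto_zero_iff_abs_tendsto_zero]
      simpa [Function.comp_def, abs_div] using hlin.const_div_atTop |μ|
    have h := ((h0.const_sub 1).mul_const σ⁻¹).abs
    rw [sub_zero, one_mul, abs_of_pos (inv_pos.2 hσ)] at h
    refine h.congr' ?_
    filter_upwards [hlin.eventually_gt_atTop 0] with ω hω
    have := abs_pos.1 hω
    rw [← abs_div]
    congr 1
    field_simp
  have hy : Tendsto (fun ω : ℝ => |(a + b * ω - μ) / σ|) atTop atTop := by
    refine (hratio.pos_mul_atTop (inv_pos.2 hσ) hlin).congr' ?_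
    filter_upwards [hlin.eventually_gt_atTop 0] with ω hω
    exact div_mul_cancel₀ _ hω.ne'
  simpa only [fEH_abs] using tendsto_fEH_div_fEH (s := s) hγ hs.1 hσ hlin hy hratio
end

section
/- Let f be a bounded symmetric probability density on ℝ, let n, p ∈ ℕ with n ≥ 1, let y₁,…,y_n ∈ ℝ and x₁,…,x_n ∈ ℝ^p with x_{1,k₀} ≠ 0 for a fixed index k₀ ∈ {1,…,p}. For k = 1,…,p let π_k be a probability density on ℝ and ν_k ∈ {0,1}, and let a_σ, b_σ > 0. Consider the joint (unnormalized) density on ℝ^p × (0,∞) given by g(β,σ) = 2σ·IG(σ²|a_σ,b_σ)·∏_{k=1}^p σ^{−ν_k}·π_k(β_k/σ^{ν_k})·∏_{i=1}^n (1/σ)·f((y_i − x_iᵀβ)/σ), where IG(t|a,b) = b^a·t^{−a−1}·e^{−b/t}/Γ(a) is the inverse-gamma density. If 0 < c ≤ n and sup_{θ∈ℝ} |θ|^c·π_{k₀}(θ) < ∞, then ∫_{ℝ^p×(0,∞)} |β_{k₀}|^c·g(β,σ) d(β,σ) < ∞; hence the posterior c-th absolute moment of β_{k₀} is finite. -/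
open MeasureTheory Real Filter Set
open scoped RealInnerProductSpace BigOperators ENNReal

/-- The inverse-gamma density `IG(t | a, b) = b^a t^{-a-1} e^{-b/t}/Γ(a)`. -/
noncomputable def igDens (t a b : ℝ) : ℝ :=
  b ^ a * t ^ (-a - 1) * Real.exp (-b / t) / Real.Gamma a

/-- The joint (unnormalized) posterior density
`g(β,σ) = 2σ·IG(σ²|a_σ,b_σ)·∏_k σ^{-ν_k} π_k(β_k/σ^{ν_k})·∏_i (1/σ) f((y_i − x_iᵀβ)/σ)`. -/
noncomputable def jointDens (n p : ℕ) (f : ℝ → ℝ) (pr : Fin p → ℝ → ℝ)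
    (ν : Fin p → ℕ) (aσ bσ : ℝ) (y : Fin n → ℝ)
    (x : Fin n → EuclideanSpace ℝ (Fin p))
    (β : EuclideanSpace ℝ (Fin p)) (σ : ℝ) : ℝ :=
  2 * σ * igDens (σ ^ 2) aσ bσ *
    (∏ k : Fin p, (σ ^ ν k)⁻¹ * pr k (β k / σ ^ ν k)) *
    ∏ i : Fin n, σ⁻¹ * f ((y i - ⟪x i, β⟫) / σ)

/-- Tonelli's inequality in the coordinate `i`, without measurability assumptions. -/
theorem lintegral_pi_le_lintegral_insertNth {m : ℕ} (i : Fin (m + 1))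
    (F : (Fin (m + 1) → ℝ) → ℝ≥0∞) :
    ∫⁻ v, F v ≤ ∫⁻ w : Fin m → ℝ, ∫⁻ t : ℝ, F (i.insertNth t w) := by
  have h₁ := (volume_preserving_piFinSuccAbove (fun _ : Fin (m + 1) => ℝ) i).symm
  have h₂ : MeasurePreserving (MeasurableEquiv.prodComm : (Fin m → ℝ) × ℝ ≃ᵐ ℝ × (Fin m → ℝ)) :=
    Measure.measurePreserving_swap
  rw [← h₁.lintegral_comp_emb (MeasurableEquiv.measurableEmbedding _),
    ← h₂.lintegral_comp_emb (MeasurableEquiv.measurableEmbedding _)]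
  exact lintegral_prod_le _

theorem lintegral_prod_pi_le_one {m : ℕ} (g : Fin m → ℝ → ℝ≥0∞) (hg : ∀ j t, g j t ≠ ⊤)
    (hg1 : ∀ j, ∫⁻ t, g j t ≤ 1) : ∫⁻ v : Fin m → ℝ, ∏ j, g j (v j) ≤ 1 := by
  induction m with
  | zero => simp [volume_pi]
  | succ m ih =>
    refine (lintegral_pi_le_lintegral_insertNth 0 _).trans ?_
    refine le_trans (lintegral_mono fun w => ?_)
      (ih (fun j => g j.succ) (fun j => hg j.succ) fun j => hg1 j.succ)
    simp only [Fin.prod_univ_succ, Fin.insertNth_zero', Fin.cons_zero, Fin.cons_succ]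
    rw [lintegral_mul_const' _ _ (ENNReal.prod_ne_top fun j _ => hg _ _)]
    exact mul_le_of_le_one_left' (hg1 0)

theorem lintegral_comp_mul_add {a : ℝ} (ha : a ≠ 0) (b : ℝ) (H : ℝ → ℝ≥0∞) :
    ∫⁻ t, H (a * t + b) = ENNReal.ofReal |a⁻¹| * ∫⁻ t, H t := by
  have h := lintegral_map_equiv (μ := (volume : Measure ℝ)) (fun t => H (t + b))
    (MeasurableEquiv.mulLeft₀ a ha)
  simp only [MeasurableEquiv.coe_mulLeft₀] at h
  rw [← h, Real.map_volume_mul_left ha, lintegral_smul_measure, smul_eq_mul,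
    lintegral_add_right_eq_self H b]

theorem lintegral_ofReal_eq_one {f : ℝ → ℝ} (hf0 : ∀ z, 0 ≤ f z) (hf1 : ∫ z, f z = 1) :
    ∫⁻ z, ENNReal.ofReal (f z) = 1 := by
  have hf : Integrable f := by
    by_contra h
    simp [integral_undef h] at hf1
  rw [← ofReal_integral_eq_lintegral_ofReal hf (.of_forall hf0), hf1, ENNReal.ofReal_one]

/-- A linear-predictor factor and the remaining coordinate densities integrate to at most
the Jacobian of the predictor in the coordinate `i`. -/
theorem lintegral_mul_prod_succAbove_le {m : ℕ} (i : Fin (m + 1)) {a : ℝ} (ha : a ≠ 0)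
    (L : (Fin m → ℝ) → ℝ) (H : ℝ → ℝ≥0∞) (g : Fin m → ℝ → ℝ≥0∞) (hg : ∀ j t, g j t ≠ ⊤)
    (hg1 : ∀ j, ∫⁻ t, g j t ≤ 1) :
    ∫⁻ v : Fin (m + 1) → ℝ, H (a * v i + L (i.removeNth v)) * ∏ j, g j (v (i.succAbove j)) ≤
      ENNReal.ofReal |a⁻¹| * ∫⁻ t, H t := by
  refine (lintegral_pi_le_lintegral_insertNth i _).trans ?_
  have hprod (w : Fin m → ℝ) : ∏ j, g j (w j) ≠ ⊤ := ENNReal.prod_ne_top fun j _ => hg _ _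
  simp only [Fin.insertNth_apply_same, Fin.insertNth_apply_succAbove, Fin.removeNth_insertNth,
    lintegral_mul_const' _ _ (hprod _), lintegral_comp_mul_add ha]
  by_cases hH : ENNReal.ofReal |a⁻¹| * ∫⁻ t, H t = ⊤
  · exact le_top.trans_eq hH.symm
  · rw [lintegral_const_mul' _ _ hH]
    exact mul_le_of_le_one_right' (lintegral_prod_pi_le_one g hg hg1)

theorem integrableOn_rpow_neg_mul_exp_neg_div_sq {b s : ℝ} (hb : 0 < b) (hs : 1 < s) :
    IntegrableOn (fun σ : ℝ => σ ^ (-s) * Real.exp (-b / σ ^ 2)) (Ioi 0) := by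
  have h := (integrableOn_Ioi_comp_rpow_iff' (fun u : ℝ => u ^ (s - 2) * Real.exp (-b * u ^ 2))
    (p := -1) (by norm_num)).2
    (integrableOn_rpow_mul_exp_neg_mul_sq hb (by linarith))
  refine h.congr_fun (fun σ hσ => ?_) measurableSet_Ioi
  have hσ : 0 < σ := hσ
  simp only [smul_eq_mul]
  rw [← rpow_mul hσ.le, ← mul_assoc, ← rpow_add hσ, rpow_neg_one, inv_pow, div_eq_mul_inv]
  congr 2
  ring

/-- The scale factor dominating the `σ`-slices of `|β_{k₀}|^c g(β,σ)` is integrable. -/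
theorem lintegral_scale_lt_top {N e : ℕ} (he : e = 0 ∨ e = 1) {aσ bσ c : ℝ} (haσ : 0 < aσ)
    (hbσ : 0 < bσ) (hcn : c ≤ N + 1) (K M d : ℝ) :
    ∫⁻ σ in Ioi (0 : ℝ), ENNReal.ofReal
      (2 * σ * igDens (σ ^ 2) aσ bσ * (K * (σ ^ e) ^ (c - 1)) * (σ⁻¹ * M) ^ N * d) < ⊤ := by
  have hs : 1 < 2 * aσ + 1 + N - e * (c - 1) := by
    have hN : (0 : ℝ) ≤ N := N.cast_nonneg
    rcases he with rfl | rfl <;> push_cast <;> linarith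
  have h := (integrableOn_rpow_neg_mul_exp_neg_div_sq hbσ hs).const_mul
    (2 * bσ ^ aσ / Real.Gamma aσ * K * M ^ N * d)
  refine IntegrableOn.setLIntegral_lt_top (IntegrableOn.congr_fun h (fun σ hσ => ?_) measurableSet_Ioi)
  have hσ : 0 < σ := hσ
  have h₁ : σ ^ (-(2 * aσ + 1 + N - e * (c - 1))) =
      σ * (σ ^ 2) ^ (-aσ - 1) * (σ ^ e) ^ (c - 1) * (σ⁻¹) ^ N := by
    rw [← rpow_natCast σ 2, ← rpow_natCast σ e, ← rpow_mul hσ.le, ← rpow_mul hσ.le,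
      ← rpow_natCast, ← rpow_neg_one, ← rpow_mul hσ.le]
    nth_rw 2 [← rpow_one σ]
    rw [← rpow_add hσ, ← rpow_add hσ, ← rpow_add hσ]
    congr 1
    push_cast
    ring
  simp only [igDens, h₁, mul_pow]
  ring

/-- Pointwise domination: the heavy-tailed prior factor absorbs `|β_i|^c`, and all likelihood
factors but the first are bounded. -/
theorem abs_rpow_mul_jointDens_le {N m : ℕ} {f : ℝ → ℝ} {M : ℝ} (hM : ∀ z, f z ≤ M)
    (hf0 : ∀ z, 0 ≤ f z) (y : Fin (N + 1) → ℝ)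
    (x : Fin (N + 1) → EuclideanSpace ℝ (Fin (m + 1))) {pr : Fin (m + 1) → ℝ → ℝ}
    (hpr0 : ∀ k t, 0 ≤ pr k t) (ν : Fin (m + 1) → ℕ) {aσ bσ : ℝ} (haσ : 0 < aσ) (hbσ : 0 < bσ)
    (i : Fin (m + 1)) {c K : ℝ} (hK : ∀ θ, |θ| ^ c * pr i θ ≤ K)
    (β : EuclideanSpace ℝ (Fin (m + 1))) {σ : ℝ} (hσ : 0 < σ) :
    |β i| ^ c * jointDens (N + 1) (m + 1) f pr ν aσ bσ y x β σ ≤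
      2 * σ * igDens (σ ^ 2) aσ bσ * (K * (σ ^ ν i) ^ (c - 1)) * (σ⁻¹ * M) ^ N *
        (σ⁻¹ * f ((y 0 - ⟪x 0, β⟫) / σ) *
          ∏ j, (σ ^ ν (i.succAbove j))⁻¹ *
            pr (i.succAbove j) (β (i.succAbove j) / σ ^ ν (i.succAbove j))) := by
  have hi : |β i| ^ c * ((σ ^ ν i)⁻¹ * pr i (β i / σ ^ ν i)) ≤ K * (σ ^ ν i) ^ (c - 1) := by
    have hs : 0 < σ ^ ν i := pow_pos hσ _
    have h₁ : |β i| ^ c = |β i / σ ^ ν i| ^ c * (σ ^ ν i) ^ c := by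
      rw [← mul_rpow (abs_nonneg _) hs.le, abs_div, abs_of_pos hs, div_mul_cancel₀ _ hs.ne']
    calc |β i| ^ c * ((σ ^ ν i)⁻¹ * pr i (β i / σ ^ ν i))
        = |β i / σ ^ ν i| ^ c * pr i (β i / σ ^ ν i) * (σ ^ ν i) ^ (c - 1) := by
          rw [h₁, rpow_sub_one hs.ne']
          ring
      _ ≤ K * (σ ^ ν i) ^ (c - 1) := by gcongr; exact hK _
  have hl : ∏ k : Fin N, σ⁻¹ * f ((y k.succ - ⟪x k.succ, β⟫) / σ) ≤ (σ⁻¹ * M) ^ N := by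
    refine (Finset.prod_le_prod (fun k _ => mul_nonneg (inv_pos.2 hσ).le (hf0 _))
      fun k _ => mul_le_mul_of_nonneg_left (hM _) (inv_pos.2 hσ).le).trans ?_
    simp
  have hl0 : 0 ≤ ∏ k : Fin N, σ⁻¹ * f ((y k.succ - ⟪x k.succ, β⟫) / σ) :=
    Finset.prod_nonneg fun k _ => mul_nonneg (inv_pos.2 hσ).le (hf0 _)
  have hi0 : 0 ≤ |β i| ^ c * ((σ ^ ν i)⁻¹ * pr i (β i / σ ^ ν i)) := by
    have := hpr0 i (β i / σ ^ ν i)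
    positivity
  have hig : 0 ≤ 2 * σ * igDens (σ ^ 2) aσ bσ := by
    have := Real.Gamma_pos_of_pos haσ
    unfold igDens
    positivity
  have hr : 0 ≤ σ⁻¹ * f ((y 0 - ⟪x 0, β⟫) / σ) *
      ∏ j, (σ ^ ν (i.succAbove j))⁻¹ *
        pr (i.succAbove j) (β (i.succAbove j) / σ ^ ν (i.succAbove j)) :=
    mul_nonneg (mul_nonneg (inv_pos.2 hσ).le (hf0 _))
      (Finset.prod_nonneg fun j _ => mul_nonneg (by positivity) (hpr0 _ _))
  rw [jointDens, Fin.prod_univ_succAbove _ i, Fin.prod_univ_succ]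
  calc _ = 2 * σ * igDens (σ ^ 2) aσ bσ *
        (|β i| ^ c * ((σ ^ ν i)⁻¹ * pr i (β i / σ ^ ν i))) *
        (∏ k : Fin N, σ⁻¹ * f ((y k.succ - ⟪x k.succ, β⟫) / σ)) *
        (σ⁻¹ * f ((y 0 - ⟪x 0, β⟫) / σ) *
          ∏ j, (σ ^ ν (i.succAbove j))⁻¹ *
            pr (i.succAbove j) (β (i.succAbove j) / σ ^ ν (i.succAbove j))) := by ring
    _ ≤ _ := mul_le_mul_of_nonneg_right
      (mul_le_mul (mul_le_mul_of_nonneg_left hi hig) hl hl0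
        (mul_nonneg hig (hi0.trans hi))) hr

theorem lintegral_scaled_density_le_one {q : ℝ → ℝ} (hq0 : ∀ t, 0 ≤ q t) (hq1 : ∫ t, q t = 1)
    {s : ℝ} (hs : 0 < s) : ∫⁻ t, ENNReal.ofReal (s⁻¹ * q (t / s)) ≤ 1 := by
  have h := lintegral_comp_mul_add (inv_ne_zero hs.ne') 0 fun t => ENNReal.ofReal (q t)
  simp only [add_zero, inv_inv, abs_of_pos hs, lintegral_ofReal_eq_one hq0 hq1, mul_one] at h
  simp_rw [ENNReal.ofReal_mul (inv_pos.2 hs).le, div_eq_inv_mul]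
  rw [lintegral_const_mul' _ _ ENNReal.ofReal_ne_top, h, ← ENNReal.ofReal_mul (inv_pos.2 hs).le,
    inv_mul_cancel₀ hs.ne', ENNReal.ofReal_one]

/-- For fixed `σ`, the first likelihood factor together with the prior factors other than the
`i`-th one has `β`-integral at most `|x_i|⁻¹`. -/
theorem lintegral_likelihood_mul_priors_le {m : ℕ} {f : ℝ → ℝ} (hf0 : ∀ z, 0 ≤ f z)
    (hf1 : ∫ z, f z = 1) (y : ℝ) (x : EuclideanSpace ℝ (Fin (m + 1)))
    {pr : Fin (m + 1) → ℝ → ℝ} (hpr0 : ∀ k t, 0 ≤ pr k t) (hpr1 : ∀ k, ∫ t, pr k t = 1)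
    (ν : Fin (m + 1) → ℕ) (i : Fin (m + 1)) (hx : x i ≠ 0) {σ : ℝ} (hσ : 0 < σ) :
    ∫⁻ β : EuclideanSpace ℝ (Fin (m + 1)), ENNReal.ofReal
      (σ⁻¹ * f ((y - ⟪x, β⟫) / σ) *
          ∏ j, (σ ^ ν (i.succAbove j))⁻¹ *
            pr (i.succAbove j) (β (i.succAbove j) / σ ^ ν (i.succAbove j))) ≤
      ENNReal.ofReal |x i|⁻¹ := by
  rw [← (PiLp.volume_preserving_toLp (Fin (m + 1))).lintegral_comp_emb
    (MeasurableEquiv.toLp 2 (Fin (m + 1) → ℝ)).measurableEmbedding]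
  have ha : -x i / σ ≠ 0 := div_ne_zero (neg_ne_zero.2 hx) hσ.ne'
  have h := lintegral_mul_prod_succAbove_le i ha
    (fun w => (y - ∑ j, w j * x (i.succAbove j)) / σ) (fun t => ENNReal.ofReal (σ⁻¹ * f t))
    (fun j t => ENNReal.ofReal ((σ ^ ν (i.succAbove j))⁻¹ *
      pr (i.succAbove j) (t / σ ^ ν (i.succAbove j))))
    (fun _ _ => ENNReal.ofReal_ne_top)
    (fun j => lintegral_scaled_density_le_one (hpr0 _) (hpr1 _) (pow_pos hσ _))
  have hH : ENNReal.ofReal |(-x i / σ)⁻¹| * ∫⁻ t, ENNReal.ofReal (σ⁻¹ * f t) =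
      ENNReal.ofReal |x i|⁻¹ := by
    simp_rw [ENNReal.ofReal_mul (inv_pos.2 hσ).le]
    rw [lintegral_const_mul' _ _ ENNReal.ofReal_ne_top, lintegral_ofReal_eq_one hf0 hf1, mul_one,
      ← ENNReal.ofReal_mul (abs_nonneg _)]
    congr 1
    rw [inv_div, abs_div, abs_neg, abs_of_pos hσ]
    field_simp
  rw [hH] at h
  refine le_trans (le_of_eq (lintegral_congr fun v => ?_)) h
  have hterm (j : Fin m) : 0 ≤ (σ ^ ν (i.succAbove j))⁻¹ *
      pr (i.succAbove j) (v (i.succAbove j) / σ ^ ν (i.succAbove j)) :=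
    mul_nonneg (by positivity) (hpr0 _ _)
  have harg : (y - ⟪x, WithLp.toLp 2 v⟫) / σ =
      -x i / σ * v i + (y - ∑ j, i.removeNth v j * x (i.succAbove j)) / σ := by
    simp only [PiLp.inner_apply, Fin.sum_univ_succAbove _ i, Fin.removeNth]
    simp
    ring
  rw [ENNReal.ofReal_mul (mul_nonneg (inv_pos.2 hσ).le (hf0 _)),
    ENNReal.ofReal_prod_of_nonneg fun j _ => hterm j, harg]


/-- **Existence of posterior moments of `β_{k₀}`.** If `f` is a bounded symmetric
probability density, `0 < c ≤ n` and `sup_θ |θ|^c π_{k₀}(θ) < ∞`, then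
`∫ |β_{k₀}|^c g(β,σ) d(β,σ) < ∞`, i.e. the posterior `c`-th absolute moment
of `β_{k₀}` is finite. -/
theorem posterior_moment_beta_finite (n p : ℕ) (hn : 0 < n) (f : ℝ → ℝ)
    (hfsym : ∀ z : ℝ, f z = f (-z)) (hfbdd : BddAbove (Set.range f))
    (hf0 : ∀ z : ℝ, 0 ≤ f z) (hf1 : ∫ z : ℝ, f z = 1)
    (y : Fin n → ℝ) (x : Fin n → EuclideanSpace ℝ (Fin p))
    (pr : Fin p → ℝ → ℝ) (hpr0 : ∀ k t, 0 ≤ pr k t) (hpr1 : ∀ k, ∫ t : ℝ, pr k t = 1)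
    (ν : Fin p → ℕ) (hν : ∀ k, ν k = 0 ∨ ν k = 1)
    (aσ bσ : ℝ) (haσ : 0 < aσ) (hbσ : 0 < bσ)
    (k₀ : Fin p) (hx1 : x ⟨0, hn⟩ k₀ ≠ 0)
    (c : ℝ) (hc : 0 < c) (hcn : c ≤ (n : ℝ))
    (hprk₀ : BddAbove (Set.range fun θ : ℝ => |θ| ^ c * pr k₀ θ)) :
    ∫⁻ q in (Set.univ ×ˢ Set.Ioi (0:ℝ) : Set (EuclideanSpace ℝ (Fin p) × ℝ)),
      ENNReal.ofReal (|q.1 k₀| ^ c * jointDens n p f pr ν aσ bσ y x q.1 q.2) < ⊤ := by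
  obtain ⟨N, rfl⟩ := Nat.exists_eq_succ_of_ne_zero hn.ne'
  obtain ⟨m, rfl⟩ := Nat.exists_eq_succ_of_ne_zero (Fin.pos k₀).ne'
  obtain ⟨M, hM⟩ := hfbdd
  obtain ⟨K, hK⟩ := hprk₀
  replace hM (z : ℝ) : f z ≤ M := hM ⟨z, rfl⟩
  replace hK (θ : ℝ) : |θ| ^ c * pr k₀ θ ≤ K := hK ⟨θ, rfl⟩
  have hM0 : 0 ≤ M := (hf0 0).trans (hM 0)
  have hK0 : 0 ≤ K := (mul_nonneg (by positivity) (hpr0 k₀ 0)).trans (hK 0)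
  have hC0 {σ : ℝ} (hσ : 0 < σ) : 0 ≤ 2 * σ * igDens (σ ^ 2) aσ bσ *
      (K * (σ ^ ν k₀) ^ (c - 1)) * (σ⁻¹ * M) ^ N := by
    have := Real.Gamma_pos_of_pos haσ
    unfold igDens
    positivity
  have hswap : MeasurePreserving
      (MeasurableEquiv.prodComm : ℝ × EuclideanSpace ℝ (Fin (m + 1)) ≃ᵐ _)
      ((volume.restrict (Ioi 0)).prod volume) (volume.prod (volume.restrict (Ioi 0))) :=
    Measure.measurePreserving_swap
  rw [Measure.volume_eq_prod, ← Measure.prod_restrict, Measure.restrict_univ,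
    ← hswap.lintegral_comp_emb (MeasurableEquiv.measurableEmbedding _)]
  refine (lintegral_prod_le _).trans_lt (lt_of_le_of_lt ?_
    (lintegral_scale_lt_top (hν k₀) haσ hbσ (by simpa using hcn) K M |x 0 k₀|⁻¹))
  refine setLIntegral_mono' measurableSet_Ioi fun σ hσ => ?_
  have hσ : 0 < σ := hσ
  change ∫⁻ β, ENNReal.ofReal
    (|β k₀| ^ c * jointDens (N + 1) (m + 1) f pr ν aσ bσ y x β σ) ≤ _
  rw [ENNReal.ofReal_mul (hC0 hσ)]
  refine le_trans (lintegral_mono fun β => ENNReal.ofReal_le_ofReal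
    (abs_rpow_mul_jointDens_le hM hf0 y x hpr0 ν haσ hbσ k₀ hK β hσ)) ?_
  simp_rw [ENNReal.ofReal_mul (hC0 hσ)]
  rw [lintegral_const_mul' _ _ ENNReal.ofReal_ne_top]
  gcongr
  exact lintegral_likelihood_mul_priors_le hf0 hf1 (y 0) (x 0) hpr0 hpr1 ν k₀ hx1 hσ
end

section
/- Let f be a bounded symmetric probability density on ℝ, let n, p ∈ ℕ with n ≥ 1, let y₁,…,y_n ∈ ℝ and x₁,…,x_n ∈ ℝ^p. For k = 1,…,p let π_k be a probability density on ℝ and ν_k ∈ {0,1}, and let a_σ, b_σ > 0. Consider the joint (unnormalized) density on ℝ^p × (0,∞) given by g(β,σ) = 2σ·IG(σ²|a_σ,b_σ)·∏_{k=1}^p σ^{−ν_k}·π_k(β_k/σ^{ν_k})·∏_{i=1}^n (1/σ)·f((y_i − x_iᵀβ)/σ), where IG(t|a,b) = b^a·t^{−a−1}·e^{−b/t}/Γ(a) is the inverse-gamma density. If d ≤ n, then ∫_{ℝ^p×(0,∞)} σ^d·g(β,σ) d(β,σ) < ∞; hence the posterior d-th moment of σ is finite. -/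
open MeasureTheory Real Filter Set
open scoped RealInnerProductSpace BigOperators ENNReal

/-- An integrable function is dominated everywhere by a measurable `ℝ≥0∞`-valued function of
finite integral. -/
theorem exists_measurable_ge_lintegral_ne_top {α : Type*} [MeasurableSpace α] {μ : Measure α}
    {g : α → ℝ} (hg : Integrable g μ) :
    ∃ G : α → ℝ≥0∞, Measurable G ∧ (∀ t, ENNReal.ofReal (g t) ≤ G t) ∧ ∫⁻ t, G t ∂μ ≠ ⊤ := by
  have hm : AEMeasurable (fun t ↦ ENNReal.ofReal (g t)) μ := hg.aemeasurable.ennreal_ofReal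
  obtain ⟨N, hsub, hN, hN0⟩ := exists_measurable_superset_of_null (ae_iff.mp hm.ae_eq_mk)
  refine ⟨fun t ↦ hm.mk _ t + N.indicator (fun _ ↦ ⊤) t,
    hm.measurable_mk.add (measurable_const.indicator hN), fun t ↦ ?_, ?_⟩
  · by_cases ht : t ∈ N
    · simp [ht]
    · have : ENNReal.ofReal (g t) = hm.mk _ t := by
        by_contra h
        exact ht (hsub h)
      simp [ht, this]
  · rw [lintegral_add_left hm.measurable_mk, lintegral_indicator_const hN, hN0, mul_zero, add_zero,
      ← lintegral_congr_ae hm.ae_eq_mk]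
    exact hg.lintegral_lt_top.ne

theorem lintegral_pi_prod_eq_prod_lintegral {n : ℕ} {F : Fin n → ℝ → ℝ≥0∞}
    (hF : ∀ k, Measurable (F k)) :
    ∫⁻ x : Fin n → ℝ, ∏ k, F k (x k) = ∏ k, ∫⁻ t, F k t := by
  induction n with
  | zero => simp [volume_pi]
  | succ n ih =>
    rw [← (volume_preserving_piFinSuccAbove (fun _ : Fin (n + 1) ↦ ℝ) 0).symm.lintegral_comp
      (f := fun x ↦ ∏ k, F k (x k)) (by fun_prop), Fin.prod_univ_succ, ← ih fun k ↦ hF k.succ]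
    simp_rw [MeasurableEquiv.piFinSuccAbove_symm_apply, Fin.insertNthEquiv, Fin.prod_univ_succ]
    exact lintegral_prod_mul (μ := volume) (ν := volume) (f := F 0)
      (g := fun x : Fin n → ℝ ↦ ∏ k, F k.succ (x k)) (hF 0).aemeasurable
      (Finset.measurable_prod _ fun k _ ↦ (hF k.succ).comp (measurable_pi_apply k)).aemeasurable

theorem lintegral_euclideanSpace_prod_eq_prod_lintegral {n : ℕ} {F : Fin n → ℝ → ℝ≥0∞}
    (hF : ∀ k, Measurable (F k)) :
    ∫⁻ β : EuclideanSpace ℝ (Fin n), ∏ k, F k (β k) = ∏ k, ∫⁻ t, F k t := by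
  rw [← lintegral_pi_prod_eq_prod_lintegral hF]
  exact (PiLp.volume_preserving_ofLp (Fin n)).lintegral_comp (f := fun x ↦ ∏ k, F k (x k))
    (by fun_prop)

theorem lintegral_inv_mul_comp_div {c : ℝ} (hc : 0 < c) {G : ℝ → ℝ≥0∞} (hG : Measurable G) :
    ∫⁻ t, ENNReal.ofReal c⁻¹ * G (t / c) = ∫⁻ t, G t := by
  have hc' : c⁻¹ ≠ 0 := inv_ne_zero hc.ne'
  rw [lintegral_const_mul _ (by fun_prop)]
  conv_rhs => rw [← Real.smul_map_volume_mul_right hc', lintegral_smul_measure,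
    lintegral_map hG (by fun_prop), abs_of_pos (inv_pos.2 hc), smul_eq_mul]
  simp_rw [div_eq_mul_inv]

theorem integrableOn_rpow_mul_exp_neg_div_sq {b e : ℝ} (hb : 0 < b) (he : e < -1) :
    IntegrableOn (fun σ : ℝ ↦ σ ^ e * exp (-b / σ ^ 2)) (Ioi 0) := by
  have h := integrableOn_rpow_mul_exp_neg_mul_rpow (p := 1) (s := (-e - 3) / 2) (b := b)
    (by linarith) one_pos hb
  rw [← integrableOn_Ioi_comp_rpow_iff' _ (p := -2) (by norm_num)] at h
  refine h.congr_fun (fun σ hσ ↦ ?_) measurableSet_Ioi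
  have hσ : 0 < σ := hσ
  have h2 : σ ^ (-2 : ℝ) = (σ ^ 2)⁻¹ := by
    rw [rpow_neg hσ.le]; norm_cast
  simp only [smul_eq_mul, rpow_one]
  rw [← rpow_mul hσ.le, ← mul_assoc, ← rpow_add hσ, h2, ← div_eq_mul_inv]
  congr 2
  ring

/-- The likelihood is at most `M ^ n * σ ^ (-n)`, so `σ ^ d` times the joint density is dominated
by a function of `σ` alone times the prior of `β`. -/
theorem rpow_mul_jointDens_le {n p : ℕ} {f : ℝ → ℝ} {M : ℝ} (hM : ∀ z, f z ≤ M)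
    (hf0 : ∀ z, 0 ≤ f z) (y : Fin n → ℝ) (x : Fin n → EuclideanSpace ℝ (Fin p))
    {pr : Fin p → ℝ → ℝ} (hpr0 : ∀ k t, 0 ≤ pr k t) (ν : Fin p → ℕ) {a b : ℝ} (ha : 0 < a)
    (hb : 0 < b) (d : ℝ) (β : EuclideanSpace ℝ (Fin p)) {σ : ℝ} (hσ : 0 < σ) :
    σ ^ d * jointDens n p f pr ν a b y x β σ ≤
      2 * b ^ a / Gamma a * M ^ n * (σ ^ (d - n - 2 * a - 1) * exp (-b / σ ^ 2)) *
        ∏ k, (σ ^ ν k)⁻¹ * pr k (β k / σ ^ ν k) := by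
  have hP : 0 ≤ ∏ k, (σ ^ ν k)⁻¹ * pr k (β k / σ ^ ν k) :=
    Finset.prod_nonneg fun k _ ↦ mul_nonneg (by positivity) (hpr0 _ _)
  have hL : ∏ i, σ⁻¹ * f ((y i - ⟪x i, β⟫) / σ) ≤ (σ⁻¹ * M) ^ n :=
    (Finset.prod_le_prod (fun i _ ↦ mul_nonneg (by positivity) (hf0 _))
      fun i _ ↦ mul_le_mul_of_nonneg_left (hM _) (by positivity)).trans_eq (by simp)
  have hΓ : 0 < Gamma a := Gamma_pos_of_pos ha
  have hpow : σ ^ (d - n - 2 * a - 1) = σ ^ d * (σ⁻¹) ^ n * σ * (σ ^ 2) ^ (-a - 1) := by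
    rw [inv_pow, ← rpow_natCast σ n, ← rpow_neg hσ.le, ← rpow_natCast σ 2, ← rpow_mul hσ.le,
      ← rpow_add hσ, ← rpow_add_one hσ.ne', ← rpow_add hσ]
    congr 1
    push_cast
    ring
  unfold jointDens igDens
  calc
    _ ≤ σ ^ d * (2 * σ * (b ^ a * (σ ^ 2) ^ (-a - 1) * exp (-b / σ ^ 2) / Gamma a) *
        (∏ k, (σ ^ ν k)⁻¹ * pr k (β k / σ ^ ν k)) * (σ⁻¹ * M) ^ n) := by gcongr
    _ = _ := by
      rw [hpow, mul_pow]
      ring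

/-- **Existence of posterior moments of `σ`.** If `f` is a bounded symmetric
probability density and `d ≤ n`, then `∫ σ^d g(β,σ) d(β,σ) < ∞`, i.e. the
posterior `d`-th moment of `σ` is finite. -/
theorem posterior_moment_sigma_finite (n p : ℕ) (hn : 0 < n) (f : ℝ → ℝ)
    (hfsym : ∀ z : ℝ, f z = f (-z)) (hfbdd : BddAbove (Set.range f))
    (hf0 : ∀ z : ℝ, 0 ≤ f z) (hf1 : ∫ z : ℝ, f z = 1)
    (y : Fin n → ℝ) (x : Fin n → EuclideanSpace ℝ (Fin p))
    (pr : Fin p → ℝ → ℝ) (hpr0 : ∀ k t, 0 ≤ pr k t) (hpr1 : ∀ k, ∫ t : ℝ, pr k t = 1)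
    (ν : Fin p → ℕ) (hν : ∀ k, ν k = 0 ∨ ν k = 1)
    (aσ bσ : ℝ) (haσ : 0 < aσ) (hbσ : 0 < bσ)
    (d : ℝ) (hd : d ≤ (n : ℝ)) :
    ∫⁻ q in (Set.univ ×ˢ Set.Ioi (0:ℝ) : Set (EuclideanSpace ℝ (Fin p) × ℝ)),
      ENNReal.ofReal (q.2 ^ d * jointDens n p f pr ν aσ bσ y x q.1 q.2) < ⊤ := by
  obtain ⟨M, hM⟩ := hfbdd
  have hM (z : ℝ) : f z ≤ M := hM ⟨z, rfl⟩
  have hM0 : 0 ≤ M := (hf0 0).trans (hM 0)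
  have hpr_int (k : Fin p) : Integrable (pr k) := by
    by_contra h
    exact zero_ne_one ((integral_undef h).symm.trans (hpr1 k))
  choose G hGm hGle hGtop using fun k ↦ exists_measurable_ge_lintegral_ne_top (hpr_int k)
  let h : ℝ → ℝ := fun σ ↦ 2 * bσ ^ aσ / Gamma aσ * M ^ n *
    (σ ^ (d - n - 2 * aσ - 1) * exp (-bσ / σ ^ 2))
  have hhm : Measurable h := by fun_prop
  have hhint : IntegrableOn h (Ioi 0) :=
    (integrableOn_rpow_mul_exp_neg_div_sq hbσ (by linarith)).const_mul _
  let H : EuclideanSpace ℝ (Fin p) × ℝ → ℝ≥0∞ := fun q ↦ ENNReal.ofReal (h q.2) *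
    ∏ k, ENNReal.ofReal (q.2 ^ ν k)⁻¹ * G k (q.1 k / q.2 ^ ν k)
  have hHm : Measurable H := by fun_prop
  calc
    _ ≤ ∫⁻ q in univ ×ˢ Ioi (0 : ℝ), H q := by
      refine setLIntegral_mono hHm fun q hq ↦ ?_
      have hσ : 0 < q.2 := hq.2
      have hh0 : 0 ≤ h q.2 := by
        have := Gamma_pos_of_pos haσ
        positivity
      refine (ENNReal.ofReal_le_ofReal
        (rpow_mul_jointDens_le hM hf0 y x hpr0 ν haσ hbσ d q.1 hσ)).trans ?_
      rw [ENNReal.ofReal_mul hh0, ENNReal.ofReal_prod_of_nonneg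
        fun k _ ↦ mul_nonneg (by positivity) (hpr0 _ _)]
      refine mul_le_mul_right (Finset.prod_le_prod' fun k _ ↦ ?_) _
      rw [ENNReal.ofReal_mul (by positivity)]
      exact mul_le_mul_right (hGle _ _) _
    _ = ∫⁻ σ in Ioi (0 : ℝ), ∫⁻ β, H (β, σ) := by
      rw [Measure.volume_eq_prod, ← Measure.prod_restrict, Measure.restrict_univ,
        lintegral_prod_symm' _ hHm]
    _ = ∫⁻ σ in Ioi (0 : ℝ), ENNReal.ofReal (h σ) * ∏ k, ∫⁻ t, G k t := by
      refine setLIntegral_congr_fun measurableSet_Ioi fun σ hσ ↦ ?_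
      have hσ : 0 < σ := hσ
      simp only [H]
      rw [lintegral_const_mul _ (by fun_prop), lintegral_euclideanSpace_prod_eq_prod_lintegral
        (F := fun k t ↦ ENNReal.ofReal (σ ^ ν k)⁻¹ * G k (t / σ ^ ν k)) fun k ↦ by fun_prop]
      congr 1
      exact Finset.prod_congr rfl fun k _ ↦ lintegral_inv_mul_comp_div (by positivity) (hGm k)
    _ < ⊤ := by
      rw [lintegral_mul_const _ (by fun_prop)]
      exact ENNReal.mul_lt_top hhint.lintegral_lt_top
        (ENNReal.prod_lt_top fun k _ ↦ (hGtop k).lt_top)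
end

section
/- Let π_HS be the horseshoe prior density on ℝ, defined by π_HS(t) = ∫₀^∞ (2/π)·(1+λ²)^{-1}·(2πλ²)^{-1/2}·exp(−t²/(2λ²)) dλ (i.e., the marginal density of β where β|λ ~ N(0,λ²) and λ follows the standard half-Cauchy distribution). Then for every c ∈ (0,2], sup_{t∈ℝ} |t|^c·π_HS(t) < ∞, even though π_HS is unbounded at the origin. -/
open MeasureTheory Real Filter Set

/-- The horseshoe prior density on `ℝ`: the marginal density of `β` where
`β | λ ~ N(0, λ²)` and `λ` is standard half-Cauchy. -/
noncomputable def horseshoeDens (t : ℝ) : ℝ :=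
  ∫ l in Set.Ioi (0:ℝ),
    (2 / Real.pi) * (1 + l ^ 2)⁻¹ *
      ((Real.sqrt (2 * Real.pi * l ^ 2))⁻¹ * Real.exp (-(t ^ 2) / (2 * l ^ 2)))

/-- The horseshoe integrand with its normalizing constant removed. -/
noncomputable def horseshoeKernel (t l : ℝ) : ℝ :=
  (1 + l ^ 2)⁻¹ * (l⁻¹ * Real.exp (-(t ^ 2) / (2 * l ^ 2)))

/-- The normalizing constant of the horseshoe density. -/
noncomputable def horseshoeConst : ℝ := (2 / Real.pi) * (Real.sqrt (2 * Real.pi))⁻¹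

lemma horseshoeConst_pos : 0 < horseshoeConst := by
  unfold horseshoeConst
  positivity

lemma horseshoeDens_eq (t : ℝ) :
    horseshoeDens t = horseshoeConst * ∫ l in Set.Ioi (0:ℝ), horseshoeKernel t l := by
  rw [horseshoeDens, ← integral_const_mul]
  refine setIntegral_congr_fun measurableSet_Ioi fun l hl => ?_
  have hl : (0:ℝ) < l := hl
  simp only [horseshoeConst, horseshoeKernel]
  rw [Real.sqrt_mul (by positivity), Real.sqrt_sq hl.le, mul_inv]
  ring

lemma horseshoeKernel_nonneg (t : ℝ) {l : ℝ} (hl : 0 < l) : 0 ≤ horseshoeKernel t l := by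
  unfold horseshoeKernel
  positivity

lemma measurable_horseshoeKernel (t : ℝ) : Measurable (horseshoeKernel t) := by
  unfold horseshoeKernel
  fun_prop

lemma rpow_mul_exp_neg_sq_le {c x : ℝ} (hc : 0 < c) (hc2 : c ≤ 2) (hx : 0 ≤ x) :
    x ^ c * Real.exp (-(x ^ 2 / 2)) ≤ 2 := by
  have h1 : x ^ c ≤ 1 + x ^ 2 := by
    rcases le_total x 1 with h | h
    · nlinarith [Real.rpow_le_one hx h hc.le, sq_nonneg x]
    · have := Real.rpow_le_rpow_of_exponent_le h hc2
      rw [Real.rpow_two] at this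
      linarith
  have h2 : x ^ c ≤ 2 * Real.exp (x ^ 2 / 2) := by
    linarith [Real.add_one_le_exp (x ^ 2 / 2)]
  rw [Real.exp_neg, ← div_eq_mul_inv, div_le_iff₀ (Real.exp_pos _)]
  exact h2

lemma rpow_mul_horseshoeKernel_le {c : ℝ} (hc : 0 < c) (hc2 : c ≤ 2) (t : ℝ) {l : ℝ}
    (hl : 0 < l) :
    |t| ^ c * horseshoeKernel t l ≤ 2 * (l ^ (c - 1) * (1 + l ^ 2)⁻¹) := by
  have h := rpow_mul_exp_neg_sq_le hc hc2 (show 0 ≤ |t| / l by positivity)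
  have he : (|t| / l) ^ 2 / 2 = t ^ 2 / (2 * l ^ 2) := by
    rw [div_pow, sq_abs]
    field_simp
  rw [he, Real.div_rpow (abs_nonneg t) hl.le] at h
  have hlc : 0 < l ^ c := Real.rpow_pos_of_pos hl c
  calc |t| ^ c * horseshoeKernel t l
      = (|t| ^ c / l ^ c * Real.exp (-(t ^ 2 / (2 * l ^ 2)))) *
          (l ^ (c - 1) * (1 + l ^ 2)⁻¹) := by
        rw [horseshoeKernel, Real.rpow_sub_one hl.ne', neg_div]
        field_simp
    _ ≤ 2 * (l ^ (c - 1) * (1 + l ^ 2)⁻¹) := by gcongr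

lemma integrableOn_rpow_mul_inv_one_add_sq {c : ℝ} (hc : 0 < c) (hc2 : c < 2) :
    IntegrableOn (fun l : ℝ => l ^ (c - 1) * (1 + l ^ 2)⁻¹) (Set.Ioi 0) := by
  have hm : Measurable fun l : ℝ => l ^ (c - 1) * (1 + l ^ 2)⁻¹ := by fun_prop
  rw [← Set.Ioc_union_Ioi_eq_Ioi zero_le_one]
  refine IntegrableOn.union ?_ ?_
  · have h : IntegrableOn (fun l : ℝ => l ^ (c - 1)) (Set.Ioc 0 1) :=
      (intervalIntegrable_iff_integrableOn_Ioc_of_le zero_le_one).1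
        (intervalIntegral.intervalIntegrable_rpow' (by linarith))
    refine Integrable.mono' h hm.aestronglyMeasurable ?_
    filter_upwards [ae_restrict_mem measurableSet_Ioc] with l hl
    have h0 : 0 < l := hl.1
    rw [Real.norm_of_nonneg (by positivity)]
    exact mul_le_of_le_one_right (by positivity)
      (inv_le_one_of_one_le₀ (by nlinarith [sq_nonneg l]))
  · have h : IntegrableOn (fun l : ℝ => l ^ (c - 3)) (Set.Ioi 1) :=
      integrableOn_Ioi_rpow_of_lt (by linarith) one_pos
    refine Integrable.mono' h hm.aestronglyMeasurable ?_
    filter_upwards [ae_restrict_mem measurableSet_Ioi] with l hl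
    have h0 : 0 < l := zero_lt_one.trans hl
    rw [Real.norm_of_nonneg (by positivity), show c - 3 = c - 1 - (2:ℝ) by ring,
      Real.rpow_sub h0 (c - 1), Real.rpow_two, div_eq_mul_inv]
    gcongr
    linarith

lemma integrableOn_horseshoeKernel {t : ℝ} (ht : t ≠ 0) :
    IntegrableOn (horseshoeKernel t) (Set.Ioi 0) := by
  have hpos : 0 < |t| := abs_pos.2 ht
  refine Integrable.mono'
    (((integrableOn_rpow_mul_inv_one_add_sq one_pos one_lt_two).const_mul 2).const_mul |t|⁻¹)
    (measurable_horseshoeKernel t).aestronglyMeasurable ?_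
  filter_upwards [ae_restrict_mem measurableSet_Ioi] with l hl
  rw [Real.norm_of_nonneg (horseshoeKernel_nonneg t hl), inv_mul_eq_div, le_div_iff₀' hpos]
  simpa only [Real.rpow_one] using rpow_mul_horseshoeKernel_le one_pos one_le_two t hl

lemma rpow_mul_integral_horseshoeKernel_le {c : ℝ} (hc : 0 < c) (hc2 : c < 2) (t : ℝ) :
    |t| ^ c * ∫ l in Set.Ioi (0:ℝ), horseshoeKernel t l ≤
      ∫ l in Set.Ioi (0:ℝ), 2 * (l ^ (c - 1) * (1 + l ^ 2)⁻¹) := by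
  rw [← integral_const_mul]
  refine integral_mono_of_nonneg ?_ ((integrableOn_rpow_mul_inv_one_add_sq hc hc2).const_mul 2) ?_
  · filter_upwards [ae_restrict_mem measurableSet_Ioi] with l hl
    exact mul_nonneg (by positivity) (horseshoeKernel_nonneg t hl)
  · filter_upwards [ae_restrict_mem measurableSet_Ioi] with l hl
    exact rpow_mul_horseshoeKernel_le hc hc2.le t hl

lemma hasDerivAt_exp_neg_sq_div (t : ℝ) {l : ℝ} (hl : 0 < l) :
    HasDerivAt (fun l : ℝ => Real.exp (-(t ^ 2) / (2 * l ^ 2)))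
      (t ^ 2 * (l ^ 3)⁻¹ * Real.exp (-(t ^ 2) / (2 * l ^ 2))) l := by
  have h := (((hasDerivAt_pow 2 l).const_mul 2).fun_inv (by positivity)).const_mul (-(t ^ 2))
  simp only [← div_eq_mul_inv] at h
  convert h.exp using 1
  field_simp
  ring

lemma tendsto_exp_neg_sq_div_nhdsGT {t : ℝ} (ht : t ≠ 0) :
    Tendsto (fun l : ℝ => Real.exp (-(t ^ 2) / (2 * l ^ 2))) (nhdsWithin 0 (Set.Ioi 0))
      (nhds 0) := by
  refine Real.tendsto_exp_atBot.comp ?_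
  have h : Tendsto (fun l : ℝ => (l⁻¹) ^ 2) (nhdsWithin 0 (Set.Ioi 0)) atTop :=
    (tendsto_pow_atTop two_ne_zero).comp tendsto_inv_nhdsGT_zero
  refine (h.const_mul_atTop_of_neg (show -(t ^ 2) / 2 < 0 by
    have : 0 < t ^ 2 := by positivity
    linarith)).congr fun l => ?_
  rw [inv_pow, ← div_eq_mul_inv, div_div]

lemma tendsto_exp_neg_sq_div_atTop (t : ℝ) :
    Tendsto (fun l : ℝ => Real.exp (-(t ^ 2) / (2 * l ^ 2))) atTop (nhds 1) := by
  rw [← Real.exp_zero]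
  refine (Real.continuous_exp.tendsto 0).comp ?_
  exact tendsto_const_nhds.div_atTop
    ((tendsto_pow_atTop two_ne_zero).const_mul_atTop two_pos)

lemma sq_mul_integral_horseshoeKernel_le {t : ℝ} (ht : t ≠ 0) :
    t ^ 2 * ∫ l in Set.Ioi (0:ℝ), horseshoeKernel t l ≤ 1 := by
  have hderiv : ∀ l ∈ Set.Ioi (0:ℝ), HasDerivAt
      (Function.update (fun l : ℝ => Real.exp (-(t ^ 2) / (2 * l ^ 2))) 0 0)
      (t ^ 2 * (l ^ 3)⁻¹ * Real.exp (-(t ^ 2) / (2 * l ^ 2))) l := fun l hl =>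
    (hasDerivAt_exp_neg_sq_div t hl).congr_of_eventuallyEq <| by
      filter_upwards [eventually_ne_nhds (ne_of_gt hl)] with x hx
      exact Function.update_of_ne hx _ _
  have hcont : ContinuousWithinAt
      (Function.update (fun l : ℝ => Real.exp (-(t ^ 2) / (2 * l ^ 2))) 0 0) (Set.Ici 0) 0 := by
    rw [continuousWithinAt_update_same, Set.Ici_sdiff_left]
    exact tendsto_exp_neg_sq_div_nhdsGT ht
  have htop : Tendsto (Function.update (fun l : ℝ => Real.exp (-(t ^ 2) / (2 * l ^ 2))) 0 0)
      atTop (nhds 1) :=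
    (tendsto_exp_neg_sq_div_atTop t).congr' <| by
      filter_upwards [eventually_ne_atTop 0] with x hx
      rw [Function.update_of_ne hx]
  have hnonneg : ∀ l ∈ Set.Ioi (0:ℝ),
      0 ≤ t ^ 2 * (l ^ 3)⁻¹ * Real.exp (-(t ^ 2) / (2 * l ^ 2)) := fun l hl => by
    have hl : 0 < l := hl
    positivity
  have hint := integrableOn_Ioi_deriv_of_nonneg hcont hderiv hnonneg htop
  have hval := integral_Ioi_of_hasDerivAt_of_nonneg hcont hderiv hnonneg htop
  rw [Function.update_self, sub_zero] at hval
  rw [← hval, ← integral_const_mul]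
  refine setIntegral_mono_on ((integrableOn_horseshoeKernel ht).const_mul _) hint
    measurableSet_Ioi fun l hl => ?_
  have hl : 0 < l := hl
  rw [horseshoeKernel, mul_assoc, ← mul_assoc _ l⁻¹, ← mul_inv]
  gcongr
  nlinarith

lemma neg_log_mul_le_integral_horseshoeKernel {t : ℝ} (ht : 0 < t) (ht1 : t ≤ 1) :
    Real.exp (-(1 / 2)) / 2 * -Real.log t ≤ ∫ l in Set.Ioi (0:ℝ), horseshoeKernel t l := by
  have hsub : Set.Ioc t 1 ⊆ Set.Ioi 0 := fun l hl => ht.trans hl.1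
  have hint := integrableOn_horseshoeKernel ht.ne'
  have hinv : IntegrableOn (fun l : ℝ => l⁻¹) (Set.Ioc t 1) :=
    (intervalIntegrable_iff_integrableOn_Ioc_of_le ht1).1
      (intervalIntegral.intervalIntegrable_inv
        (fun l hl => (ht.trans_le (Set.uIcc_of_le ht1 ▸ hl).1).ne') continuousOn_id)
  calc Real.exp (-(1 / 2)) / 2 * -Real.log t
      = ∫ l in Set.Ioc t 1, Real.exp (-(1 / 2)) / 2 * l⁻¹ := by
        rw [integral_const_mul, ← intervalIntegral.integral_of_le ht1,
          integral_inv_of_pos ht one_pos, one_div t, Real.log_inv]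
    _ ≤ ∫ l in Set.Ioc t 1, horseshoeKernel t l := by
        refine setIntegral_mono_on (hinv.const_mul _) (hint.mono_set hsub)
          measurableSet_Ioc fun l hl => ?_
        have hl0 : 0 < l := hsub hl
        have h1 : (2:ℝ)⁻¹ ≤ (1 + l ^ 2)⁻¹ := by
          gcongr
          nlinarith [hl.2]
        have h2 : -(1 / 2) ≤ -(t ^ 2) / (2 * l ^ 2) := by
          rw [le_div_iff₀ (by positivity)]
          nlinarith [hl.1]
        calc Real.exp (-(1 / 2)) / 2 * l⁻¹
            = 2⁻¹ * (l⁻¹ * Real.exp (-(1 / 2))) := by ring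
          _ ≤ horseshoeKernel t l := by
            rw [horseshoeKernel]
            gcongr
    _ ≤ ∫ l in Set.Ioi (0:ℝ), horseshoeKernel t l := by
        refine setIntegral_mono_set hint ?_ hsub.eventuallyLE
        filter_upwards [ae_restrict_mem measurableSet_Ioi] with l hl
        exact horseshoeKernel_nonneg t hl

/-- For every `c ∈ (0,2]`, `sup_{t ∈ ℝ} |t|^c π_HS(t) < ∞`, even though the
horseshoe density `π_HS` is unbounded (at the origin). -/
theorem horseshoe_moment_bounded :
    (∀ c : ℝ, c ∈ Set.Ioc (0:ℝ) 2 →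
        BddAbove (Set.range fun t : ℝ => |t| ^ c * horseshoeDens t)) ∧
      ¬ BddAbove (Set.range horseshoeDens) := by
  constructor
  · rintro c ⟨hc, hc2⟩
    rcases hc2.lt_or_eq with hlt | rfl
    · refine ⟨horseshoeConst * ∫ l in Set.Ioi (0:ℝ), 2 * (l ^ (c - 1) * (1 + l ^ 2)⁻¹), ?_⟩
      rintro _ ⟨t, rfl⟩
      simp only [horseshoeDens_eq]
      rw [mul_left_comm]
      exact mul_le_mul_of_nonneg_left (rpow_mul_integral_horseshoeKernel_le hc hlt t)
        horseshoeConst_pos.le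
    · refine ⟨horseshoeConst, ?_⟩
      rintro _ ⟨t, rfl⟩
      simp only [horseshoeDens_eq, Real.rpow_two, sq_abs]
      rcases eq_or_ne t 0 with rfl | ht
      · simpa using horseshoeConst_pos.le
      · rw [mul_left_comm]
        exact mul_le_of_le_one_right horseshoeConst_pos.le
          (sq_mul_integral_horseshoeKernel_le ht)
  · rintro ⟨M, hM⟩
    set a := horseshoeConst * (Real.exp (-(1 / 2)) / 2) with ha
    have ha0 : 0 < a := mul_pos horseshoeConst_pos (by positivity)
    set s := (|M| + 1) / a with hs
    have hs0 : 0 < s := by positivity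
    have hle := hM ⟨Real.exp (-s), rfl⟩
    have hlog := neg_log_mul_le_integral_horseshoeKernel (Real.exp_pos (-s))
      (Real.exp_le_one_iff.2 (by linarith))
    rw [Real.log_exp, neg_neg] at hlog
    have hlow := mul_le_mul_of_nonneg_left hlog horseshoeConst_pos.le
    rw [← horseshoeDens_eq, ← mul_assoc, ← ha, hs, mul_div_cancel₀ _ ha0.ne'] at hlow
    linarith [le_abs_self M]
end
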